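/- arXiv:2501.12066 — 5 statements merged into one kernel-verified Lean document; each statement's English description precedes it below -/
import Mathlib

section
/- Let p and q be probability measures on a measurable space X with p ≪ q and finite relative entropy D = ∫ log₂(dp/dq) dp, and let δ > 0 with relative-entropy δ-typical set A(δ) = {x : D − δ ≤ log₂((dp/dq)(x)) ≤ D + δ}. Suppose p(A(δ)) ≥ 1 − ε for some ε ∈ [0,1), and let B ⊆ X be any measurable set with p(B) ≥ 1 − ε' for some ε' ∈ [0,1). Then q(B) ≥ (1 − ε − ε') · 2^{−(D + δ)}. -/
open MeasureTheory Filter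

/-- If `dμ/dν ≤ c` holds `ν`-almost everywhere on `s`, then `μ s ≤ c * ν s`. -/
theorem measure_le_mul_of_rnDeriv_le {X : Type*} [MeasurableSpace X] {μ ν : Measure X}
    [SigmaFinite μ] [SigmaFinite ν] (hac : μ ≪ ν) {s : Set X} (hs : MeasurableSet s)
    {c : ENNReal} (h : ∀ᵐ x ∂ν, x ∈ s → μ.rnDeriv ν x ≤ c) : μ s ≤ c * ν s :=
  calc μ s = ∫⁻ x in s, μ.rnDeriv ν x ∂ν := (Measure.setLIntegral_rnDeriv hac s).symm
    _ ≤ ∫⁻ _ in s, c ∂ν := setLIntegral_mono_ae' hs h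
    _ = c * ν s := setLIntegral_const s c

/-- Bonferroni's inequality for two events. -/
theorem measureReal_add_sub_one_le_inter {X : Type*} [MeasurableSpace X] {μ : Measure X}
    [IsProbabilityMeasure μ] (s : Set X) {t : Set X} (ht : MeasurableSet t) :
    μ.real s + μ.real t - 1 ≤ μ.real (s ∩ t) := by
  have h := measureReal_union_add_inter (μ := μ) (s := s) ht
  have h_le : μ.real (s ∪ t) ≤ 1 := measureReal_le_one
  linarith

/-- **`q`-probability lower bound for high `p`-probability sets.** If `p ≪ q` are probability
measures with finite relative entropy `D = ∫ log₂ (dp/dq) dp`, `δ > 0`, the relative-entropy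
`δ`-typical set `A(δ)` satisfies `p (A(δ)) ≥ 1 - ε`, and `B` is any measurable set with
`p B ≥ 1 - ε'`, then `q B ≥ (1 - ε - ε') * 2 ^ (-(D + δ))`. -/
theorem q_measure_lower_bound_of_high_p_probability
    {X : Type*} [MeasurableSpace X] (p q : Measure X)
    [IsProbabilityMeasure p] [IsProbabilityMeasure q]
    (hac : p ≪ q)
    (D : ℝ)
    (h_int : Integrable (fun x => Real.logb 2 ((p.rnDeriv q x).toReal)) p)
    (hD : D = ∫ x, Real.logb 2 ((p.rnDeriv q x).toReal) ∂p)
    (δ : ℝ) (hδ : 0 < δ)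
    (ε ε' : ℝ) (hε0 : 0 ≤ ε) (hε1 : ε < 1) (hε'0 : 0 ≤ ε') (hε'1 : ε' < 1)
    (hA : ENNReal.ofReal (1 - ε) ≤
      p {x | D - δ ≤ Real.logb 2 ((p.rnDeriv q x).toReal) ∧
             Real.logb 2 ((p.rnDeriv q x).toReal) ≤ D + δ})
    (B : Set X) (hB_meas : MeasurableSet B)
    (hB : ENNReal.ofReal (1 - ε') ≤ p B) :
    ENNReal.ofReal ((1 - ε - ε') * (2 : ℝ) ^ (-(D + δ))) ≤ q B := by
  set A : Set X := {x | D - δ ≤ Real.logb 2 ((p.rnDeriv q x).toReal) ∧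
    Real.logb 2 ((p.rnDeriv q x).toReal) ≤ D + δ}
  have hf : Measurable fun x => Real.logb 2 ((p.rnDeriv q x).toReal) :=
    (Real.measurable_log.comp (Measure.measurable_rnDeriv p q).ennreal_toReal).div_const _
  have hA_meas : MeasurableSet A :=
    (measurableSet_le measurable_const hf).inter (measurableSet_le hf measurable_const)
  have hc : (0 : ℝ) < 2 ^ (D + δ) := by positivity
  have h_upper : p (A ∩ B) ≤ ENNReal.ofReal (2 ^ (D + δ)) * q (A ∩ B) := by
    refine measure_le_mul_of_rnDeriv_le hac (hA_meas.inter hB_meas) ?_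
    filter_upwards [Measure.rnDeriv_lt_top p q] with x hx hxAB
    rw [← ENNReal.ofReal_toReal hx.ne]
    refine ENNReal.ofReal_le_ofReal ?_
    rcases (ENNReal.toReal_nonneg (a := p.rnDeriv q x)).eq_or_lt with h0 | hpos
    · exact h0 ▸ hc.le
    · exact (Real.logb_le_iff_le_rpow one_lt_two hpos).1 hxAB.1.2
  have h_real : p.real (A ∩ B) ≤ 2 ^ (D + δ) * q.real (A ∩ B) := by
    have h := ENNReal.toReal_mono (by finiteness) h_upper
    rwa [ENNReal.toReal_mul, ENNReal.toReal_ofReal hc.le] at h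
  have hA_real : 1 - ε ≤ p.real A := (ENNReal.ofReal_le_iff_le_toReal (by finiteness)).1 hA
  have hB_real : 1 - ε' ≤ p.real B := (ENNReal.ofReal_le_iff_le_toReal (by finiteness)).1 hB
  have h_inter := measureReal_add_sub_one_le_inter (μ := p) A hB_meas
  have h_mono : q.real (A ∩ B) ≤ q.real B := measureReal_mono Set.inter_subset_right
  rw [ENNReal.ofReal_le_iff_le_toReal (by finiteness), Real.rpow_neg zero_le_two,
    ← div_eq_mul_inv]
  refine le_trans ?_ h_mono
  rw [div_le_iff₀' hc]
  linarith
end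

section
/- Let p and q be probability measures on a measurable space X with p ≪ q and finite relative entropy D = ∫ log₂(dp/dq) dp, and for δ > 0 let A(δ) = {x : D − δ ≤ log₂((dp/dq)(x)) ≤ D + δ}. Fix 0 < τ < 1/2 and define β_τ = inf{ q(B) : B ⊆ X measurable, p(X \ B) < τ }. If γ > 0 satisfies p(A(γ)) > 1 − τ, and δ > 0 and ε ∈ [0,1) satisfy p(A(δ)) ≥ 1 − ε and ε + τ < 1, then (1 − ε − τ) · 2^{−(D + δ)} ≤ β_τ ≤ 2^{−(D − γ)}. -/
open MeasureTheory Filter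

/-- The minimal type-II error `β_τ = inf { q B : B measurable, p Bᶜ < τ }` of the binary
hypothesis test between `p` and `q` with type-I error constraint `τ`. -/
noncomputable def minTypeIIError {X : Type*} [MeasurableSpace X]
    (p q : Measure X) (τ : ℝ) : ENNReal :=
  sInf {v | ∃ B : Set X, MeasurableSet B ∧ p Bᶜ < ENNReal.ofReal τ ∧ v = q B}

namespace MeasureTheory.Measure

variable {X : Type*} [MeasurableSpace X] {p q : Measure X}

theorem le_mul_of_rnDeriv_le [SigmaFinite p] [SigmaFinite q] (hac : p ≪ q) {s : Set X}
    (hs : MeasurableSet s) {c : ENNReal} (h : ∀ᵐ x ∂q, x ∈ s → p.rnDeriv q x ≤ c) :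
    p s ≤ c * q s := by
  rw [← setLIntegral_rnDeriv hac s, ← setLIntegral_const]
  exact setLIntegral_mono_ae' hs h

theorem mul_le_of_le_rnDeriv [SigmaFinite p] [SigmaFinite q] (hac : p ≪ q) {s : Set X}
    (hs : MeasurableSet s) {c : ENNReal} (h : ∀ᵐ x ∂q, x ∈ s → c ≤ p.rnDeriv q x) :
    c * q s ≤ p s := by
  rw [← setLIntegral_rnDeriv hac s, ← setLIntegral_const]
  exact setLIntegral_mono_ae' hs h

theorem measurable_logb_toReal_rnDeriv (p q : Measure X) (b : ℝ) :
    Measurable fun x => Real.logb b (p.rnDeriv q x).toReal :=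
  ((measurable_rnDeriv p q).ennreal_toReal.log).div_const _

end MeasureTheory.Measure

theorem ENNReal.le_ofReal_rpow_of_logb_toReal_le {b : ℝ} (hb : 1 < b) {r : ENNReal} (hr : r ≠ ⊤)
    {t : ℝ} (h : Real.logb b r.toReal ≤ t) : r ≤ ENNReal.ofReal (b ^ t) := by
  rw [← ENNReal.ofReal_toReal hr]
  apply ENNReal.ofReal_le_ofReal
  rcases ENNReal.toReal_nonneg.eq_or_lt with h0 | h0
  · rw [← h0]
    positivity
  · exact (Real.logb_le_iff_le_rpow hb h0).1 h

theorem ENNReal.ofReal_rpow_le_of_le_logb_toReal {b : ℝ} (hb : 1 < b) {r : ENNReal}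
    (hr0 : r ≠ 0) {t : ℝ} (h : t ≤ Real.logb b r.toReal) : ENNReal.ofReal (b ^ t) ≤ r := by
  by_cases hr : r = ⊤
  · simp [hr]
  rw [← ENNReal.ofReal_toReal hr]
  exact ENNReal.ofReal_le_ofReal
    ((Real.le_logb_iff_rpow_le hb (ENNReal.toReal_pos hr0 hr)).1 h)

/-- **Two-sided bounds on the optimal type-II error.** Let `p ≪ q` be probability measures with
finite relative entropy `D = ∫ log₂ (dp/dq) dp`, and `A(δ)` the relative-entropy `δ`-typical
set. Fix `0 < τ < 1/2`. If `γ > 0` satisfies `p (A(γ)) > 1 - τ`, and `δ > 0`, `ε ∈ [0,1)`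
satisfy `p (A(δ)) ≥ 1 - ε` and `ε + τ < 1`, then
`(1 - ε - τ) * 2 ^ (-(D + δ)) ≤ β_τ ≤ 2 ^ (-(D - γ))`. -/
theorem minTypeIIError_bounds
    {X : Type*} [MeasurableSpace X] (p q : Measure X)
    [IsProbabilityMeasure p] [IsProbabilityMeasure q]
    (hac : p ≪ q)
    (D : ℝ)
    (h_int : Integrable (fun x => Real.logb 2 ((p.rnDeriv q x).toReal)) p)
    (hD : D = ∫ x, Real.logb 2 ((p.rnDeriv q x).toReal) ∂p)
    (τ : ℝ) (hτ0 : 0 < τ) (hτ1 : τ < 1/2)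
    (γ : ℝ) (hγ : 0 < γ)
    (hAγ : ENNReal.ofReal (1 - τ) <
      p {x | D - γ ≤ Real.logb 2 ((p.rnDeriv q x).toReal) ∧
             Real.logb 2 ((p.rnDeriv q x).toReal) ≤ D + γ})
    (δ : ℝ) (hδ : 0 < δ)
    (ε : ℝ) (hε0 : 0 ≤ ε) (hε1 : ε < 1) (hετ : ε + τ < 1)
    (hAδ : ENNReal.ofReal (1 - ε) ≤
      p {x | D - δ ≤ Real.logb 2 ((p.rnDeriv q x).toReal) ∧
             Real.logb 2 ((p.rnDeriv q x).toReal) ≤ D + δ}) :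
    ENNReal.ofReal ((1 - ε - τ) * (2 : ℝ) ^ (-(D + δ))) ≤ minTypeIIError p q τ ∧
      minTypeIIError p q τ ≤ ENNReal.ofReal ((2 : ℝ) ^ (-(D - γ))) := by
  have hmeas : ∀ η : ℝ, MeasurableSet {x | D - η ≤ Real.logb 2 ((p.rnDeriv q x).toReal) ∧
      Real.logb 2 ((p.rnDeriv q x).toReal) ≤ D + η} := fun η =>
    (measurableSet_le measurable_const (Measure.measurable_logb_toReal_rnDeriv p q 2)).inter
      (measurableSet_le (Measure.measurable_logb_toReal_rnDeriv p q 2) measurable_const)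
  constructor
  · refine le_sInf ?_
    rintro _ ⟨B, hB, hpB, rfl⟩
    set A := {x | D - δ ≤ Real.logb 2 ((p.rnDeriv q x).toReal) ∧
      Real.logb 2 ((p.rnDeriv q x).toReal) ≤ D + δ}
    have hAB : p (A ∩ B) ≤ ENNReal.ofReal (2 ^ (D + δ)) * q B := by
      refine (Measure.le_mul_of_rnDeriv_le hac ((hmeas δ).inter hB) ?_).trans
        (mul_le_mul_right (measure_mono Set.inter_subset_right) _)
      filter_upwards [Measure.rnDeriv_ne_top p q] with x hx hxA
      exact ENNReal.le_ofReal_rpow_of_logb_toReal_le one_lt_two hx hxA.1.2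
    have hlow : ENNReal.ofReal (1 - ε - τ) ≤ p (A ∩ B) := by
      rw [ENNReal.ofReal_sub _ hτ0.le, tsub_le_iff_right]
      calc ENNReal.ofReal (1 - ε) ≤ p A := hAδ
        _ ≤ p (A ∩ B) + p (A \ B) := measure_le_inter_add_sdiff p A B
        _ ≤ p (A ∩ B) + ENNReal.ofReal τ := by
          gcongr
          exact (measure_mono (Set.sdiff_subset_compl _ _)).trans hpB.le
    have hpos : (0 : ℝ) < 2 ^ (D + δ) := by positivity
    rw [Real.rpow_neg zero_le_two, ← div_eq_mul_inv, ENNReal.ofReal_div_of_pos hpos]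
    exact ENNReal.div_le_of_le_mul' (hlow.trans hAB)
  · set A := {x | D - γ ≤ Real.logb 2 ((p.rnDeriv q x).toReal) ∧
      Real.logb 2 ((p.rnDeriv q x).toReal) ≤ D + γ}
    have hS : MeasurableSet {x | p.rnDeriv q x ≠ 0} :=
      (Measure.measurable_rnDeriv p q) (measurableSet_singleton 0).compl
    have hB : MeasurableSet (A ∩ {x | p.rnDeriv q x ≠ 0}) := (hmeas γ).inter hS
    have hpB : p (A ∩ {x | p.rnDeriv q x ≠ 0}) = p A := by
      refine measure_congr (inter_ae_eq_left_of_ae_eq_univ ?_)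
      filter_upwards [Measure.rnDeriv_pos hac] with x hx
      exact eq_true hx.ne'
    refine le_trans (sInf_le ⟨A ∩ {x | p.rnDeriv q x ≠ 0}, hB, ?_, rfl⟩) ?_
    · rw [prob_compl_eq_one_sub hB, hpB]
      refine ENNReal.sub_lt_of_lt_add prob_le_one ?_
      calc (1 : ENNReal) = ENNReal.ofReal τ + ENNReal.ofReal (1 - τ) := by
            rw [← ENNReal.ofReal_add hτ0.le (by linarith)]
            simp
        _ < ENNReal.ofReal τ + p A := ENNReal.add_lt_add_left ENNReal.ofReal_ne_top hAγ
    · have hpos : (0 : ℝ) < 2 ^ (D - γ) := by positivity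
      rw [Real.rpow_neg zero_le_two, ENNReal.ofReal_inv_of_pos hpos,
        ENNReal.le_inv_iff_mul_le, mul_comm]
      refine (Measure.mul_le_of_le_rnDeriv hac hB ?_).trans prob_le_one
      exact ae_of_all _ fun x hx =>
        ENNReal.ofReal_rpow_le_of_le_logb_toReal one_lt_two hx.2 hx.1.1
end

section
/- (Generalized Chernoff–Stein Lemma.) For each n ∈ ℕ let X_n be a measurable space and let p_n, q_n be probability measures on X_n with p_n ≪ q_n and finite relative entropy D_n = ∫ log₂(dp_n/dq_n) dp_n. Fix 0 < τ < 1/2 and set β_{τ,n} = inf{ q_n(B) : B ⊆ X_n measurable, p_n(Bᶜ) < τ }. Assume (i) D_n → ∞ as n → ∞, and (ii) for every ξ > 0 there exists a sequence of positive reals (δ_n) such that, for all sufficiently large n, δ_n ≤ ξ·D_n and p_n({x : D_n − δ_n ≤ log₂((dp_n/dq_n)(x)) ≤ D_n + δ_n}) ≥ 1 − τ. Then (−log₂ β_{τ,n}) / D_n → 1 as n → ∞; that is, −log₂ β_{τ,n} = D_n + o(D_n). -/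
open MeasureTheory Filter

section LogLikelihood

variable {X : Type*} [MeasurableSpace X] {p q : Measure X}

theorem measurable_logb_rnDeriv :
    Measurable (fun x => Real.logb 2 ((p.rnDeriv q x).toReal)) := by
  unfold Real.logb
  have := Measure.measurable_rnDeriv p q
  fun_prop

/-- If the type-I error of the test `{a ≤ log₂ (dp/dq)}` is below `τ`, then `β_τ ≤ 2 ^ (-a)`. -/
theorem minTypeIIError_le_rpow [IsProbabilityMeasure p] [SigmaFinite q] {τ a : ℝ} (ha : 0 < a)
    (h : p {x | a ≤ Real.logb 2 ((p.rnDeriv q x).toReal)}ᶜ < ENNReal.ofReal τ) :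
    minTypeIIError p q τ ≤ ENNReal.ofReal (2 ^ (-a)) := by
  set B := {x | a ≤ Real.logb 2 ((p.rnDeriv q x).toReal)}
  have hBm : MeasurableSet B := measurableSet_le measurable_const measurable_logb_rnDeriv
  have hβ : minTypeIIError p q τ ≤ q B := sInf_le ⟨B, hBm, h, rfl⟩
  refine hβ.trans ?_
  have hle : ENNReal.ofReal (2 ^ a) * q B ≤ 1 := by
    calc ENNReal.ofReal (2 ^ a) * q B = ∫⁻ _ in B, ENNReal.ofReal (2 ^ a) ∂q := by simp
      _ ≤ ∫⁻ x in B, p.rnDeriv q x ∂q := by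
        refine setLIntegral_mono (Measure.measurable_rnDeriv p q) fun x hx => ?_
        have hx' : a ≤ Real.logb 2 ((p.rnDeriv q x).toReal) := hx
        have hpos : 0 < (p.rnDeriv q x).toReal := by
          refine ENNReal.toReal_nonneg.lt_of_ne' fun h0 => ?_
          rw [h0, Real.logb_zero] at hx'
          linarith
        exact (ENNReal.ofReal_le_ofReal
          ((Real.le_logb_iff_rpow_le one_lt_two hpos).1 hx')).trans ENNReal.ofReal_toReal_le
      _ ≤ p B := Measure.setLIntegral_rnDeriv_le B
      _ ≤ 1 := prob_le_one
  rw [Real.rpow_neg zero_le_two, ENNReal.ofReal_inv_of_pos (by positivity)]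
  rwa [ENNReal.le_inv_iff_mul_le, mul_comm]

/-- If `log₂ (dp/dq) ≤ b` has `p`-probability at least `1 - τ`, then
`(1 - 2 τ) 2 ^ (-b) ≤ β_τ`. -/
theorem rpow_le_minTypeIIError [IsProbabilityMeasure p] [IsFiniteMeasure q] (hac : p ≪ q)
    {τ b : ℝ} (hτ : 0 ≤ τ)
    (h : ENNReal.ofReal (1 - τ) ≤ p {x | Real.logb 2 ((p.rnDeriv q x).toReal) ≤ b}) :
    ENNReal.ofReal ((1 - 2 * τ) * 2 ^ (-b)) ≤ minTypeIIError p q τ := by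
  refine le_sInf ?_
  rintro _ ⟨B, hBm, hB, rfl⟩
  set A := {x | Real.logb 2 ((p.rnDeriv q x).toReal) ≤ b}
  have hAm : MeasurableSet A := measurableSet_le measurable_logb_rnDeriv measurable_const
  have hAB : ENNReal.ofReal (1 - 2 * τ) ≤ p (A ∩ B) := by
    have hsub : p A ≤ p (A ∩ B) + p Bᶜ := by
      refine (measure_mono fun x hx => ?_).trans (measure_union_le _ _)
      by_cases hxB : x ∈ B
      · exact Or.inl ⟨hx, hxB⟩
      · exact Or.inr hxB
    rw [show 1 - 2 * τ = (1 - τ) - τ by ring, ENNReal.ofReal_sub _ hτ, tsub_le_iff_right]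
    exact h.trans (hsub.trans (by gcongr))
  have hle : p (A ∩ B) ≤ ENNReal.ofReal (2 ^ b) * q B := by
    calc p (A ∩ B) = ∫⁻ x in A ∩ B, p.rnDeriv q x ∂q := (Measure.setLIntegral_rnDeriv hac _).symm
      _ ≤ ∫⁻ _ in A ∩ B, ENNReal.ofReal (2 ^ b) ∂q := by
        refine lintegral_mono_ae ?_
        filter_upwards [ae_restrict_mem (hAm.inter hBm),
          ae_restrict_of_ae (Measure.rnDeriv_lt_top p q)] with x hx hfin
        rw [← ENNReal.ofReal_toReal hfin.ne]
        refine ENNReal.ofReal_le_ofReal ?_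
        rcases ENNReal.toReal_nonneg.eq_or_lt with h0 | hpos
        · rw [← h0]; positivity
        · exact (Real.logb_le_iff_le_rpow one_lt_two hpos).1 hx.1
      _ = ENNReal.ofReal (2 ^ b) * q (A ∩ B) := by simp
      _ ≤ ENNReal.ofReal (2 ^ b) * q B := by gcongr; exact Set.inter_subset_right
  have hpos : (0 : ℝ) < 2 ^ b := by positivity
  rw [Real.rpow_neg zero_le_two, ← div_eq_mul_inv, ENNReal.ofReal_div_of_pos hpos]
  exact ENNReal.div_le_of_le_mul' (hAB.trans hle)

end LogLikelihood

/-- Let `f` have positive mean `D`. If `f` lies in `[(1 - τ ξ) D, (1 + τ ξ) D]` with probability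
at least `1 - τ`, then `f < (1 - ξ) D` has probability strictly less than `τ`: otherwise the
lower tail would pull the mean below `D`. -/
theorem measure_lower_tail_lt {X : Type*} [MeasurableSpace X] {p : Measure X}
    [IsProbabilityMeasure p] {f : X → ℝ} (hf : Measurable f) (hfi : Integrable f p)
    {D τ ξ : ℝ} (hD : D = ∫ x, f x ∂p) (hD0 : 0 < D) (hτ0 : 0 < τ) (hτ1 : τ ≤ 1) (hξ : 0 < ξ)
    (h : ENNReal.ofReal (1 - τ) ≤ p {x | (1 - τ * ξ) * D ≤ f x ∧ f x ≤ (1 + τ * ξ) * D}) :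
    p {x | (1 - ξ) * D ≤ f x}ᶜ < ENNReal.ofReal τ := by
  set A := {x | (1 - τ * ξ) * D ≤ f x ∧ f x ≤ (1 + τ * ξ) * D}
  set B := {x | (1 - ξ) * D ≤ f x}
  have hBm : MeasurableSet B := measurableSet_le measurable_const hf
  have hAm : MeasurableSet A :=
    (measurableSet_le measurable_const hf).inter (measurableSet_le hf measurable_const)
  have hAB : A ⊆ B := fun x hx => by
    have : (1 - ξ) * D ≤ (1 - τ * ξ) * D := by gcongr; nlinarith
    exact this.trans hx.1
  by_contra! hcon
  have hcompl : τ ≤ p.real Bᶜ := (ENNReal.ofReal_le_iff_le_toReal (measure_ne_top _ _)).1 hcon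
  have hsum : p.real B + p.real Bᶜ = 1 := by
    rw [measureReal_add_measureReal_compl hBm, probReal_univ]
  have hpA : 1 - τ ≤ p.real A := (ENNReal.ofReal_le_iff_le_toReal (measure_ne_top _ _)).1 h
  have hdiff : p (B \ A) = 0 := by
    have h1 : p.real (B \ A) = p.real B - p.real A := measureReal_sdiff hAB hAm
    have h2 : p.real (B \ A) = 0 := le_antisymm (by linarith) measureReal_nonneg
    exact (measureReal_eq_zero_iff).1 h2
  have hae : f ≤ᵐ[p] fun x => B.indicator (fun _ => (τ * ξ + ξ) * D) x + (1 - ξ) * D := by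
    filter_upwards [measure_eq_zero_iff_ae_notMem.1 hdiff] with x hx
    by_cases hxB : x ∈ B
    · have hxA : x ∈ A := by
        by_contra hxA
        exact hx ⟨hxB, hxA⟩
      rw [Set.indicator_of_mem hxB]
      linarith [hxA.2]
    · rw [Set.indicator_of_notMem hxB, zero_add]
      exact (not_le.1 hxB).le
  have hind : Integrable (B.indicator fun _ => (τ * ξ + ξ) * D) p :=
    (integrable_const _).indicator hBm
  have hint := integral_mono_ae hfi (hind.fun_add (integrable_const _)) hae
  rw [← hD, integral_add hind (integrable_const _), integral_indicator_const _ hBm] at hint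
  simp only [integral_const, probReal_univ, smul_eq_mul, one_mul] at hint
  have hB1 : p.real B * ((τ * ξ + ξ) * D) ≤ (1 - τ) * ((τ * ξ + ξ) * D) := by
    gcongr; linarith
  have : 0 < τ * τ * ξ * D := by positivity
  nlinarith

/-- **Generalized Chernoff–Stein Lemma.** For each `n`, let `p n ≪ q n` be probability measures
on `X n` with finite relative entropy `D n = ∫ log₂ (d(p n)/d(q n)) d(p n)`, and fix
`0 < τ < 1/2`. Assume `D n → ∞` and that for every `ξ > 0` there is a sequence of positive
reals `δ` such that eventually `δ n ≤ ξ * D n` and the relative-entropy `δ n`-typical set has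
`p n`-probability at least `1 - τ`. Then `(-log₂ β_{τ,n}) / D n → 1`. -/
theorem generalized_chernoff_stein
    {X : ℕ → Type*} [∀ n, MeasurableSpace (X n)]
    (p q : (n : ℕ) → Measure (X n))
    [∀ n, IsProbabilityMeasure (p n)] [∀ n, IsProbabilityMeasure (q n)]
    (hac : ∀ n, p n ≪ q n)
    (D : ℕ → ℝ)
    (h_int : ∀ n, Integrable (fun x => Real.logb 2 (((p n).rnDeriv (q n) x).toReal)) (p n))
    (hD : ∀ n, D n = ∫ x, Real.logb 2 (((p n).rnDeriv (q n) x).toReal) ∂(p n))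
    (τ : ℝ) (hτ0 : 0 < τ) (hτ1 : τ < 1/2)
    (hDtop : Tendsto D atTop atTop)
    (hgood : ∀ ξ > (0 : ℝ), ∃ δ : ℕ → ℝ, (∀ n, 0 < δ n) ∧
      (∀ᶠ n in atTop, δ n ≤ ξ * D n ∧
        ENNReal.ofReal (1 - τ) ≤
          (p n) {x | D n - δ n ≤ Real.logb 2 (((p n).rnDeriv (q n) x).toReal) ∧
                     Real.logb 2 (((p n).rnDeriv (q n) x).toReal) ≤ D n + δ n})) :
    Tendsto (fun n => (-Real.logb 2 ((minTypeIIError (p n) (q n) τ).toReal)) / D n)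
      atTop (nhds 1) := by
  rw [Metric.tendsto_nhds]
  intro ε hε
  set ξ := min (ε / 4) (1 / 2)
  have hξ0 : 0 < ξ := lt_min (by positivity) (by norm_num)
  have hξε : ξ ≤ ε / 4 := min_le_left _ _
  have hξ1 : ξ ≤ 1 / 2 := min_le_right _ _
  obtain ⟨δ, -, hδ⟩ := hgood (τ * ξ) (by positivity)
  filter_upwards [hδ, hDtop.eventually_gt_atTop 0,
    hDtop.eventually_ge_atTop (-Real.logb 2 (1 - 2 * τ) / ξ)] with n ⟨hδn, hmass⟩ hD0 hDlarge
  have htyp := hmass.trans (measure_mono (μ := p n)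
    (t := {x | (1 - τ * ξ) * D n ≤ Real.logb 2 (((p n).rnDeriv (q n) x).toReal) ∧
      Real.logb 2 (((p n).rnDeriv (q n) x).toReal) ≤ (1 + τ * ξ) * D n})
    fun x hx => ⟨by linarith [hx.1], by linarith [hx.2]⟩)
  have hupper := minTypeIIError_le_rpow (a := (1 - ξ) * D n) (mul_pos (by linarith) hD0)
    (measure_lower_tail_lt measurable_logb_rnDeriv (h_int n) (hD n) hD0 hτ0 (by linarith) hξ0 htyp)
  have hlower := rpow_le_minTypeIIError (hac n) (b := (1 + τ * ξ) * D n) hτ0.le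
    (htyp.trans (measure_mono fun x hx => hx.2))
  have htop := (hupper.trans_lt ENNReal.ofReal_lt_top).ne
  have hu := ENNReal.toReal_le_of_le_ofReal (by positivity) hupper
  have hl := (ENNReal.ofReal_le_iff_le_toReal htop).1 hlower
  have hτ2 : 0 < 1 - 2 * τ := by linarith
  have hβ : 0 < (minTypeIIError (p n) (q n) τ).toReal := lt_of_lt_of_le (by positivity) hl
  have hlogu := Real.logb_le_logb_of_le one_lt_two hβ hu
  have hlogl := Real.logb_le_logb_of_le one_lt_two (by positivity) hl
  rw [Real.logb_rpow two_pos (by norm_num)] at hlogu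
  rw [Real.logb_mul hτ2.ne' (by positivity), Real.logb_rpow two_pos (by norm_num)] at hlogl
  rw [div_le_iff₀ hξ0] at hDlarge
  have hτξ : τ * ξ * D n ≤ ξ * D n := by
    gcongr
    exact mul_le_of_le_one_left hξ0.le (by linarith)
  have hξD : ξ * D n ≤ ε / 4 * D n := by gcongr
  have hεD : 0 < ε * D n := by positivity
  rw [Real.dist_eq, abs_lt, lt_sub_iff_add_lt, sub_lt_iff_lt_add, lt_div_iff₀ hD0, div_lt_iff₀ hD0]
  constructor <;> linarith
end

section
/- (Chernoff–Stein lemma, IID case on a general measurable space.) Let p₁ and q₁ be probability measures on a measurable space X with p₁ ≪ q₁ and finite relative entropy D = ∫ log₂(dp₁/dq₁) dp₁. For n ∈ ℕ let p^n and q^n be the n-fold product measures on Xⁿ, fix 0 < τ < 1/2, and set β_{τ,n} = inf{ q^n(B) : B ⊆ Xⁿ measurable, p^n(Bᶜ) < τ }. Then −(1/n) log₂ β_{τ,n} → D as n → ∞. -/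
open MeasureTheory Filter

/-- The product of finitely many copies of a measure with density `f` has density
`x ↦ ∏ i, f (x i)`. -/
lemma pi_withDensity {ι X : Type*} [Fintype ι] [MeasurableSpace X] (q : Measure X)
    [IsProbabilityMeasure q] {f : X → ENNReal} (hf : Measurable f) [SigmaFinite (q.withDensity f)] :
    Measure.pi (fun _ : ι => q.withDensity f) =
      (Measure.pi fun _ : ι => q).withDensity fun x => ∏ i, f (x i) := by
  refine Measure.pi_eq fun s hs => ?_
  have hg (i : ι) : Measurable ((s i).indicator f) := hf.indicator (hs i)
  have hprod : (Set.univ.pi s).indicator (fun x : ι → X => ∏ i, f (x i)) =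
      fun x => ∏ i, (s i).indicator f (x i) := by
    classical
    ext x
    by_cases hx : x ∈ Set.univ.pi s
    · rw [Set.indicator_of_mem hx]
      exact Finset.prod_congr rfl fun i _ => (Set.indicator_of_mem (hx i trivial) f).symm
    · rw [Set.indicator_of_notMem hx]
      simp only [Set.mem_pi, Set.mem_univ, true_implies, not_forall] at hx
      obtain ⟨i, hi⟩ := hx
      exact (Finset.prod_eq_zero (Finset.mem_univ i) (Set.indicator_of_notMem hi f)).symm
  have hms : MeasurableSet (Set.univ.pi s) := MeasurableSet.univ_pi hs
  rw [withDensity_apply _ hms, ← lintegral_indicator hms, hprod,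
    ProbabilityTheory.lintegral_prod_eq_prod_lintegral_of_indepFun Finset.univ
      (fun i (x : ι → X) => (s i).indicator f (x i))
      (ProbabilityTheory.iIndepFun_pi fun i => (hg i).aemeasurable) (fun i => by fun_prop)]
  refine Finset.prod_congr rfl fun i _ => ?_
  rw [(measurePreserving_eval (fun _ : ι => q) i).lintegral_comp (hg i),
    lintegral_indicator (hs i), withDensity_apply _ (hs i)]

/-- The weak law of large numbers on the finite powers of a probability space. -/
lemma tendsto_pi_average_deviation {X : Type*} [MeasurableSpace X] (p : Measure X)
    [IsProbabilityMeasure p] {g : X → ℝ} (hg : Measurable g) (hgi : Integrable g p)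
    {ε : ℝ} (hε : 0 < ε) :
    Tendsto (fun n : ℕ => (Measure.pi fun _ : Fin n => p)
      {x | ε ≤ |(∑ i, g (x i)) / n - ∫ x, g x ∂p|}) atTop (nhds 0) := by
  have hmp (i : ℕ) := measurePreserving_eval_infinitePi (fun _ : ℕ => p) i
  have hlaw := ProbabilityTheory.strong_law_ae_real (μ := Measure.infinitePi fun _ : ℕ => p)
    (fun i x => g (x i)) ((hmp 0).integrable_comp_of_integrable hgi)
    (fun i j hij => (ProbabilityTheory.iIndepFun_infinitePi
      (X := fun _ : ℕ => g) fun _ => hg).indepFun hij)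
    (fun i => ⟨(hg.comp (hmp i).measurable).aemeasurable,
      (hg.comp (hmp 0).measurable).aemeasurable,
      (Measure.map_map hg (hmp i).measurable).symm.trans
        (((hmp i).map_eq.trans (hmp 0).map_eq.symm ▸ rfl : _ = _).trans
          (Measure.map_map hg (hmp 0).measurable))⟩)
  have hmean : ∫ x, g (x 0) ∂(Measure.infinitePi fun _ : ℕ => p) = ∫ x, g x ∂p := by
    have := integral_map (hmp 0).measurable.aemeasurable
      (hg.aestronglyMeasurable
      (μ := Measure.map (Function.eval 0) (Measure.infinitePi fun _ : ℕ => p)))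
    rw [(hmp 0).map_eq] at this
    exact this.symm
  rw [hmean] at hlaw
  have hconv := tendstoInMeasure_iff_norm.1 (tendstoInMeasure_of_tendsto_ae
    (fun n => Measurable.aestronglyMeasurable (by fun_prop)) hlaw) ε hε
  refine hconv.congr fun n => ?_
  have hmap := Measure.map_infinitePi_infinitePi_of_inj (P := fun _ : ℕ => p)
    (f := fun i : Fin n => (i : ℕ)) Fin.val_injective
  rw [Measure.infinitePi_eq_pi (μ := fun _ : Fin n => p)] at hmap
  rw [← hmap, Measure.map_apply (by fun_prop)
    (measurableSet_le measurable_const (by fun_prop))]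
  simp only [Set.preimage_ofPred_eq, Real.norm_eq_abs, Finset.sum_range]

/-- A likelihood-ratio test `{a ≤ F}` bounds the minimal type-II error from above. -/
lemma minTypeIIError_withDensity_le {Y : Type*} [MeasurableSpace Y] (q : Measure Y)
    {F : Y → ENNReal} (hF : Measurable F) [IsProbabilityMeasure (q.withDensity F)]
    {τ : ℝ} {a : ENNReal} (ha0 : a ≠ 0) (ha : a ≠ ⊤)
    (h : q.withDensity F {y | a ≤ F y}ᶜ < ENNReal.ofReal τ) :
    minTypeIIError (q.withDensity F) q τ ≤ a⁻¹ := by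
  have hle : minTypeIIError (q.withDensity F) q τ ≤ q {y | a ≤ F y} :=
    sInf_le ⟨_, measurableSet_le measurable_const hF, h, rfl⟩
  refine hle.trans ?_
  rw [← one_div, ENNReal.le_div_iff_mul_le (.inl ha0) (.inl ha), mul_comm]
  calc a * q {y | a ≤ F y} ≤ ∫⁻ y, F y ∂q := mul_meas_ge_le_lintegral hF a
    _ = q.withDensity F Set.univ := by rw [withDensity_apply _ .univ, Measure.restrict_univ]
    _ = 1 := measure_univ

/-- If the likelihood ratio `F` is likely to be at most `b`, then the minimal type-II error is
bounded from below. -/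
lemma le_minTypeIIError_withDensity {Y : Type*} [MeasurableSpace Y] (q : Measure Y)
    {F : Y → ENNReal} (hF : Measurable F) [IsProbabilityMeasure (q.withDensity F)]
    {τ : ℝ} {b δ : ENNReal} (h : q.withDensity F {y | F y ≤ b}ᶜ ≤ δ) :
    (1 - (ENNReal.ofReal τ + δ)) / b ≤ minTypeIIError (q.withDensity F) q τ := by
  refine le_sInf ?_
  rintro _ ⟨B, hB, hBτ, rfl⟩
  refine ENNReal.div_le_of_le_mul (tsub_le_iff_left.2 ?_)
  have hA : MeasurableSet {y | F y ≤ b} := measurableSet_le hF measurable_const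
  have hBA : q.withDensity F (B ∩ {y | F y ≤ b}) ≤ q B * b := by
    rw [withDensity_apply _ (hB.inter hA)]
    calc ∫⁻ y in B ∩ {y | F y ≤ b}, F y ∂q ≤ ∫⁻ _ in B ∩ {y | F y ≤ b}, b ∂q :=
          setLIntegral_mono measurable_const fun y hy => hy.2
      _ = b * q (B ∩ {y | F y ≤ b}) := setLIntegral_const _ _
      _ ≤ q B * b := by rw [mul_comm]; gcongr; exact Set.inter_subset_left
  calc (1 : ENNReal) = q.withDensity F Set.univ := measure_univ.symm
    _ ≤ q.withDensity F ((Bᶜ ∪ {y | F y ≤ b}ᶜ) ∪ (B ∩ {y | F y ≤ b})) := by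
        rw [← Set.compl_inter, Set.compl_union_self]
    _ ≤ q.withDensity F Bᶜ + q.withDensity F {y | F y ≤ b}ᶜ
          + q.withDensity F (B ∩ {y | F y ≤ b}) :=
        (measure_union_le _ _).trans (by gcongr; exact measure_union_le _ _)
    _ ≤ ENNReal.ofReal τ + δ + q B * b := by gcongr

/-- The likelihood ratio of `n` i.i.d. samples from `p` concentrates, on the exponential scale,
around `2 ^ (n * D)`. -/
lemma tendsto_pi_rnDeriv_atypical {X : Type*} [MeasurableSpace X] (p q : Measure X)
    [IsProbabilityMeasure p] [IsProbabilityMeasure q] (hac : p ≪ q)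
    (h_int : Integrable (fun x => Real.logb 2 ((p.rnDeriv q x).toReal)) p)
    {ε : ℝ} (hε : 0 < ε) :
    Tendsto (fun n : ℕ => (Measure.pi fun _ : Fin n => p)
      {x | ENNReal.ofReal
            (2 ^ (n * ((∫ x, Real.logb 2 ((p.rnDeriv q x).toReal) ∂p) - ε))) ≤
              ∏ i, p.rnDeriv q (x i) ∧
          ∏ i, p.rnDeriv q (x i) ≤ ENNReal.ofReal
            (2 ^ (n * ((∫ x, Real.logb 2 ((p.rnDeriv q x).toReal) ∂p) + ε)))}ᶜ)
      atTop (nhds 0) := by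
  set D := ∫ x, Real.logb 2 ((p.rnDeriv q x).toReal) ∂p
  have hmeas : Measurable fun x => Real.logb 2 ((p.rnDeriv q x).toReal) :=
    (Measure.measurable_rnDeriv p q).ennreal_toReal.log.div_const _
  refine tendsto_of_tendsto_of_tendsto_of_le_of_le' tendsto_const_nhds
    (tendsto_pi_average_deviation p hmeas h_int hε) (.of_forall fun _ => zero_le) ?_
  filter_upwards [eventually_gt_atTop 0] with n hn
  refine measure_mono_ae ?_
  have hpos : ∀ᵐ x ∂(Measure.pi fun _ : Fin n => p), ∀ i,
      0 < p.rnDeriv q (x i) ∧ p.rnDeriv q (x i) < ⊤ :=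
    ae_all_iff.2 fun i => (Measure.quasiMeasurePreserving_eval (fun _ : Fin n => p) i).ae
      ((Measure.rnDeriv_pos hac).and (hac.ae_le (Measure.rnDeriv_lt_top p q)))
  filter_upwards [hpos] with x hx
  have hprod : ∏ i, p.rnDeriv q (x i) =
      ENNReal.ofReal (2 ^ ∑ i, Real.logb 2 ((p.rnDeriv q (x i)).toReal)) := by
    rw [Real.rpow_sum_of_pos two_pos, ENNReal.ofReal_prod_of_nonneg fun i _ => by positivity]
    refine Finset.prod_congr rfl fun i _ => ?_
    rw [Real.rpow_logb two_pos (by norm_num) (ENNReal.toReal_pos (hx i).1.ne' (hx i).2.ne),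
      ENNReal.ofReal_toReal (hx i).2.ne]
  have hn' : (0 : ℝ) < n := by exact_mod_cast hn
  intro hxA
  change ε ≤ |_|
  by_contra! hdev
  refine hxA ?_
  change _ ≤ _ ∧ _ ≤ _
  rw [abs_lt, lt_sub_iff_add_lt, lt_div_iff₀ hn', sub_lt_iff_lt_add, div_lt_iff₀ hn'] at hdev
  rw [hprod]
  constructor <;> refine ENNReal.ofReal_le_ofReal (Real.rpow_le_rpow_of_exponent_le one_le_two ?_)
  · linarith
  · linarith

/-- **Chernoff–Stein lemma, IID case.** Let `p₁ ≪ q₁` be probability measures on a measurable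
space `X` with finite relative entropy `D = ∫ log₂ (dp₁/dq₁) dp₁`. For each `n` let `p^n`,
`q^n` be the `n`-fold product measures on `Xⁿ` and let `β_{τ,n}` be the minimal type-II error
subject to type-I error below `τ ∈ (0, 1/2)`. Then `-(1/n) log₂ β_{τ,n} → D`. -/
theorem chernoff_stein_iid
    {X : Type*} [MeasurableSpace X] (p₁ q₁ : Measure X)
    [IsProbabilityMeasure p₁] [IsProbabilityMeasure q₁]
    (hac : p₁ ≪ q₁)
    (D : ℝ)
    (h_int : Integrable (fun x => Real.logb 2 ((p₁.rnDeriv q₁ x).toReal)) p₁)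
    (hD : D = ∫ x, Real.logb 2 ((p₁.rnDeriv q₁ x).toReal) ∂p₁)
    (τ : ℝ) (hτ0 : 0 < τ) (hτ1 : τ < 1/2) :
    Tendsto (fun n : ℕ =>
        -(1 / (n : ℝ)) * Real.logb 2
          ((minTypeIIError (Measure.pi fun _ : Fin n => p₁)
            (Measure.pi fun _ : Fin n => q₁) τ).toReal))
      atTop (nhds D) := by
  subst hD
  set D := ∫ x, Real.logb 2 ((p₁.rnDeriv q₁ x).toReal) ∂p₁
  rw [Metric.tendsto_atTop']
  intro ε hε
  have htyp := tendsto_pi_rnDeriv_atypical p₁ q₁ hac h_int (half_pos hε)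
  have hsmall : ∀ᶠ n : ℕ in atTop, 2 / (n : ℝ) < ε / 2 :=
    (tendsto_const_div_atTop_nhds_zero_nat 2).eventually_lt_const (half_pos hε)
  obtain ⟨N, hN⟩ := eventually_atTop.1 ((((htyp.eventually_lt_const
    (ENNReal.ofReal_pos.2 hτ0)).and (htyp.eventually_lt_const
    (ENNReal.ofReal_pos.2 (show (0 : ℝ) < 1 / 4 by norm_num)))).and hsmall).and
    (eventually_gt_atTop 0))
  refine ⟨N, fun n hn => ?_⟩
  obtain ⟨⟨⟨hτA, hA⟩, hns⟩, hn0⟩ := hN n hn.le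
  have hn' : (0 : ℝ) < n := by exact_mod_cast hn0
  have hwd : q₁.withDensity (p₁.rnDeriv q₁) = p₁ := Measure.withDensity_rnDeriv_eq _ _ hac
  have hpi : (Measure.pi fun _ : Fin n => p₁) =
      (Measure.pi fun _ : Fin n => q₁).withDensity fun x => ∏ i, p₁.rnDeriv q₁ (x i) := by
    have : SigmaFinite (q₁.withDensity (p₁.rnDeriv q₁)) := by rw [hwd]; infer_instance
    rw [← pi_withDensity q₁ (Measure.measurable_rnDeriv p₁ q₁), hwd]
  have hF : Measurable fun x : Fin n → X => ∏ i, p₁.rnDeriv q₁ (x i) := by fun_prop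
  have hprob : IsProbabilityMeasure ((Measure.pi fun _ : Fin n => q₁).withDensity
      fun x => ∏ i, p₁.rnDeriv q₁ (x i)) := by rw [← hpi]; infer_instance
  rw [hpi] at hτA hA ⊢
  have hup := minTypeIIError_withDensity_le _ hF
    (ENNReal.ofReal_pos.2 (by positivity)).ne' ENNReal.ofReal_ne_top
    ((measure_mono (Set.compl_subset_compl.2 fun x hx => hx.1)).trans_lt hτA)
  have hlow := le_minTypeIIError_withDensity _ hF (τ := τ)
    ((measure_mono (Set.compl_subset_compl.2 fun x hx => hx.2)).trans hA.le)
  set β := minTypeIIError ((Measure.pi fun _ : Fin n => q₁).withDensity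
    fun x => ∏ i, p₁.rnDeriv q₁ (x i)) (Measure.pi fun _ : Fin n => q₁) τ
  rw [← ENNReal.ofReal_inv_of_pos (by positivity), ← Real.rpow_neg zero_le_two] at hup
  have hβ : β ≠ ⊤ := ne_top_of_le_ne_top ENNReal.ofReal_ne_top hup
  have hup' : β.toReal ≤ 2 ^ (-(n * (D - ε / 2))) :=
    ENNReal.toReal_le_of_le_ofReal (by positivity) hup
  have hlow' : (2 : ℝ) ^ (-2 - n * (D + ε / 2)) ≤ β.toReal := by
    rw [← ENNReal.ofReal_add hτ0.le (by norm_num), ← ENNReal.ofReal_one,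
      ← ENNReal.ofReal_sub _ (by positivity), ← ENNReal.ofReal_div_of_pos (by positivity),
      ENNReal.ofReal_le_iff_le_toReal hβ] at hlow
    refine le_trans ?_ hlow
    rw [Real.rpow_sub two_pos]
    gcongr
    norm_num [Real.rpow_neg]
    linarith
  have hβ0 : 0 < β.toReal := lt_of_lt_of_le (by positivity) hlow'
  have hlog_up : Real.logb 2 β.toReal ≤ -(n * (D - ε / 2)) :=
    (Real.logb_le_iff_le_rpow one_lt_two hβ0).2 hup'
  have hlog_low : -2 - n * (D + ε / 2) ≤ Real.logb 2 β.toReal :=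
    (Real.le_logb_iff_rpow_le one_lt_two hβ0).2 hlow'
  rw [div_lt_iff₀ hn'] at hns
  have heq : -(1 / (n : ℝ)) * Real.logb 2 β.toReal = -Real.logb 2 β.toReal / n := by ring
  rw [Real.dist_eq, heq, abs_lt, lt_sub_iff_add_lt, lt_div_iff₀ hn', sub_lt_iff_lt_add,
    div_lt_iff₀ hn']
  constructor <;> nlinarith [mul_pos hε hn']
end

section
/- Let K_p, K_q : ℤ → ℝ be even, absolutely summable functions with spectra S_p(f) = Σ_{m∈ℤ} K_p(m) e^{−2πi f m} and S_q(f) = Σ_{m∈ℤ} K_q(m) e^{−2πi f m} (real-valued and continuous on [0,1]), and assume there exist constants 0 < c ≤ M with c ≤ S_p(f) ≤ M and c ≤ S_q(f) ≤ M for all f ∈ [0,1]. For n ∈ ℕ let Λ_p^{(n)} and Λ_q^{(n)} be the n×n symmetric Toeplitz matrices with entries K_p(i−j) and K_q(i−j) respectively (which are then positive definite), and let D_n denote the relative entropy (in nats) of N(0, Λ_p^{(n)}) with respect to N(0, Λ_q^{(n)}). Then (1/n) D_n → C_s as n → ∞, where C_s = (1/2) ∫₀¹ ( S_p(f)/S_q(f)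 − ln( S_p(f)/S_q(f) ) − 1 ) df. -/
open MeasureTheory Filter Matrix

/-- The spectrum `S(f) = Σ_{m ∈ ℤ} K(m) e^{-2πi f m}` of an even, absolutely summable
auto-covariance function `K : ℤ → ℝ`; by evenness it equals the real cosine series. -/
noncomputable def spectrum' (K : ℤ → ℝ) (f : ℝ) : ℝ :=
  ∑' m : ℤ, K m * Real.cos (2 * Real.pi * f * (m : ℝ))

/-- The `n × n` symmetric Toeplitz matrix with entries `K(i - j)`. -/
def toeplitz (K : ℤ → ℝ) (n : ℕ) : Matrix (Fin n) (Fin n) ℝ :=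
  fun i j => K ((i : ℤ) - (j : ℤ))

/-- The density of the centered multivariate Gaussian `N(0, Λ)` on `ℝⁿ`. -/
noncomputable def gaussianPdf (n : ℕ) (Λ : Matrix (Fin n) (Fin n) ℝ) (x : Fin n → ℝ) : ℝ :=
  (Real.sqrt ((2 * Real.pi) ^ n * Λ.det))⁻¹ * Real.exp (-(x ⬝ᵥ (Λ⁻¹ *ᵥ x)) / 2)

/-- The centered multivariate Gaussian measure `N(0, Λ)` on `ℝⁿ`. -/
noncomputable def gaussianMeasure (n : ℕ) (Λ : Matrix (Fin n) (Fin n) ℝ) :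
    Measure (Fin n → ℝ) :=
  volume.withDensity fun x => ENNReal.ofReal (gaussianPdf n Λ x)

/-- The relative entropy `D(p ‖ q) = ∫ ln (dp/dq) dp` in nats. -/
noncomputable def relEntropyNats {X : Type*} [MeasurableSpace X] (p q : Measure X) : ℝ :=
  ∫ x, Real.log ((p.rnDeriv q x).toReal) ∂p

section Gaussian

open ProbabilityTheory

variable {n : ℕ}

lemma continuous_gaussianPdf (Λ : Matrix (Fin n) (Fin n) ℝ) : Continuous (gaussianPdf n Λ) := by
  unfold gaussianPdf
  have : Continuous fun x : Fin n → ℝ => x ⬝ᵥ (Λ⁻¹ *ᵥ x) :=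
    continuous_id.dotProduct (continuous_const.matrix_mulVec continuous_id)
  fun_prop

lemma gaussianPdf_pos {Λ : Matrix (Fin n) (Fin n) ℝ} (hΛ : Λ.PosDef) (x : Fin n → ℝ) :
    0 < gaussianPdf n Λ x := by
  have := hΛ.det_pos
  unfold gaussianPdf
  positivity

lemma gaussianPdf_one (y : Fin n → ℝ) :
    gaussianPdf n 1 y = ∏ i, gaussianPDFReal 0 1 (y i) := by
  simp only [gaussianPdf, gaussianPDFReal, Finset.prod_mul_distrib, Finset.prod_const,
    Finset.card_univ, Fintype.card_fin, det_one, mul_one, inv_one, one_mulVec, dotProduct,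
    NNReal.coe_one, sub_zero, ← Real.exp_sum]
  congr 1
  · rw [inv_pow, Real.sqrt_eq_rpow, Real.sqrt_eq_rpow, ← Real.rpow_natCast, ← Real.rpow_natCast,
      ← Real.rpow_mul (by positivity), ← Real.rpow_mul (by positivity), mul_comm (n : ℝ)]
  · congr 1
    rw [neg_div, Finset.sum_div, ← Finset.sum_neg_distrib]
    exact Finset.sum_congr rfl fun i _ => by ring

lemma gaussianPdf_mul_transpose {B : Matrix (Fin n) (Fin n) ℝ} (hB : B.det ≠ 0)
    (y : Fin n → ℝ) :
    gaussianPdf n (B * Bᵀ) (B *ᵥ y) = |B.det|⁻¹ * gaussianPdf n 1 y := by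
  have hu : IsUnit B.det := hB.isUnit
  have hquad : (B *ᵥ y) ⬝ᵥ ((B * Bᵀ)⁻¹ *ᵥ (B *ᵥ y)) = y ⬝ᵥ y := by
    rw [Matrix.mul_inv_rev, ← mulVec_mulVec, mulVec_mulVec _ B⁻¹, nonsing_inv_mul _ hu,
      one_mulVec, dotProduct_mulVec, ← mulVec_transpose, transpose_nonsing_inv,
      transpose_transpose, mulVec_mulVec, nonsing_inv_mul _ hu, one_mulVec]
  have hdet : Real.sqrt ((2 * Real.pi) ^ n * (B * Bᵀ).det)
      = Real.sqrt ((2 * Real.pi) ^ n) * |B.det| := by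
    rw [det_mul, det_transpose, Real.sqrt_mul (by positivity), Real.sqrt_mul_self_eq_abs]
  simp only [gaussianPdf, hquad, hdet, det_one, mul_one, inv_one, one_mulVec, mul_inv]
  ring

lemma measurableEmbedding_mulVec {B : Matrix (Fin n) (Fin n) ℝ} (hB : B.det ≠ 0) :
    MeasurableEmbedding fun y : Fin n → ℝ => B *ᵥ y := by
  have hdet : LinearMap.det (toLin' B) ≠ 0 := by rwa [LinearMap.det_toLin']
  exact (LinearMap.equivOfDetNeZero
    (toLin' B) hdet).toContinuousLinearEquiv.toHomeomorph.measurableEmbedding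

lemma integral_gaussianPdf_mul {B : Matrix (Fin n) (Fin n) ℝ} (hB : B.det ≠ 0)
    (h : (Fin n → ℝ) → ℝ) :
    ∫ x, gaussianPdf n (B * Bᵀ) x * h x = ∫ y, gaussianPdf n 1 y * h (B *ᵥ y) := by
  have hmap := Real.map_matrix_volume_pi_eq_smul_volume_pi hB
  have key := (measurableEmbedding_mulVec hB).integral_map (μ := volume)
    fun x => gaussianPdf n (B * Bᵀ) x * h x
  have hfun : (⇑(toLin' B) : (Fin n → ℝ) → _) = fun y => B *ᵥ y := rfl
  rw [hfun] at hmap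
  rw [hmap, integral_smul_measure, ENNReal.toReal_ofReal (abs_nonneg _)] at key
  simp only [gaussianPdf_mul_transpose hB, mul_assoc, integral_const_mul, abs_inv,
    smul_eq_mul] at key
  exact mul_left_cancel₀ (inv_ne_zero (abs_ne_zero.2 hB)) key

lemma integrable_gaussianPdf_mul {B : Matrix (Fin n) (Fin n) ℝ} (hB : B.det ≠ 0)
    {h : (Fin n → ℝ) → ℝ} (hint : Integrable fun y => gaussianPdf n 1 y * h (B *ᵥ y)) :
    Integrable fun x => gaussianPdf n (B * Bᵀ) x * h x := by
  have hmap := Real.map_matrix_volume_pi_eq_smul_volume_pi hB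
  have key := (measurableEmbedding_mulVec hB).integrable_map_iff (μ := volume)
    (g := fun x => gaussianPdf n (B * Bᵀ) x * h x)
  have hfun : (⇑(toLin' B) : (Fin n → ℝ) → _) = fun y => B *ᵥ y := rfl
  have hpos : 0 < |B.det⁻¹| := abs_pos.2 (inv_ne_zero hB)
  rw [hfun] at hmap
  rw [hmap, integrable_smul_measure (by simpa using hpos) ENNReal.ofReal_ne_top] at key
  refine key.2 ?_
  simpa [Function.comp_def, gaussianPdf_mul_transpose hB, mul_assoc] using
    hint.const_mul |B.det|⁻¹

lemma gaussianPdf_one_mul_mul (i j : Fin n) (y : Fin n → ℝ) :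
    gaussianPdf n 1 y * (y i * y j) = ∏ k, (gaussianPDFReal 0 1 (y k) *
      ((if k = i then y k else 1) * (if k = j then y k else 1))) := by
  rw [Finset.prod_mul_distrib, Finset.prod_mul_distrib, gaussianPdf_one]
  simp

lemma integrable_gaussianPDFReal_mul {h : ℝ → ℝ} (hh : Integrable h (gaussianReal 0 1)) :
    Integrable fun x => gaussianPDFReal 0 1 x * h x := by
  rw [gaussianReal_of_var_ne_zero _ one_ne_zero,
    integrable_withDensity_iff_integrable_smul' (measurable_gaussianPDF _ _)
      (ae_of_all _ fun _ => ENNReal.ofReal_lt_top)] at hh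
  simpa [toReal_gaussianPDF] using hh

lemma integrable_pow_gaussianReal (k : ℕ) :
    Integrable (fun x : ℝ => x ^ k) (gaussianReal 0 1) := by
  simpa using (memLp_id_gaussianReal (μ := 0) (v := 1) k).integrable_norm_pow' |>.mono'
    (by fun_prop) (by simp)

lemma integral_sq_gaussianReal : ∫ x, x ^ 2 ∂gaussianReal 0 1 = 1 := by
  have h := variance_id_gaussianReal (μ := 0) (v := 1)
  rw [variance_of_integral_eq_zero aemeasurable_id (by simp)] at h
  simpa using h

lemma integrable_gaussianPdf_one_mul_mul (i j : Fin n) :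
    Integrable fun y : Fin n → ℝ => gaussianPdf n 1 y * (y i * y j) := by
  simp only [gaussianPdf_one_mul_mul]
  refine Integrable.fintype_prod (f := fun k x => gaussianPDFReal 0 1 x *
      ((if k = i then x else 1) * (if k = j then x else 1))) fun k =>
    integrable_gaussianPDFReal_mul ?_
  have h1 := integrable_pow_gaussianReal 1
  have h2 := integrable_pow_gaussianReal 2
  simp only [pow_one, sq] at h1 h2
  split_ifs <;> simp [h1, h2]

lemma integral_gaussianPdf_one_mul_mul (i j : Fin n) :
    ∫ y : Fin n → ℝ, gaussianPdf n 1 y * (y i * y j) = (1 : Matrix (Fin n) (Fin n) ℝ) i j := by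
  simp only [gaussianPdf_one_mul_mul]
  rw [integral_fintype_prod_volume_eq_prod (fun k x => gaussianPDFReal 0 1 x *
      ((if k = i then x else 1) * (if k = j then x else 1)))]
  have hred : ∀ h : ℝ → ℝ, ∫ x, gaussianPDFReal 0 1 x * h x = ∫ x, h x ∂gaussianReal 0 1 :=
    fun h => (integral_gaussianReal_eq_integral_smul one_ne_zero).symm
  simp only [hred]
  by_cases hij : i = j
  · subst hij
    rw [one_apply_eq]
    refine Finset.prod_eq_one fun k _ => ?_
    have h2 := integral_sq_gaussianReal
    simp only [sq] at h2
    split_ifs <;> simp [h2]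
  · rw [one_apply_ne hij]
    refine Finset.prod_eq_zero (Finset.mem_univ i) ?_
    simp [hij]

lemma integral_gaussianPdf_one : ∫ y : Fin n → ℝ, gaussianPdf n 1 y = 1 := by
  simp only [gaussianPdf_one]
  rw [integral_fintype_prod_volume_eq_prod fun _ => gaussianPDFReal 0 1]
  simp [integral_gaussianPDFReal_eq_one]

lemma integrable_gaussianPdf_one : Integrable fun y : Fin n → ℝ => gaussianPdf n 1 y := by
  simp only [gaussianPdf_one]
  exact Integrable.fintype_prod fun _ => integrable_gaussianPDFReal 0 1

lemma gaussianPdf_one_mul_quadratic (A : Matrix (Fin n) (Fin n) ℝ) (y : Fin n → ℝ) :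
    gaussianPdf n 1 y * (y ⬝ᵥ (A *ᵥ y))
      = ∑ i, ∑ j, A i j * (gaussianPdf n 1 y * (y i * y j)) := by
  simp only [dotProduct, mulVec, Finset.mul_sum]
  exact Finset.sum_congr rfl fun i _ => Finset.sum_congr rfl fun j _ => by ring

lemma integrable_gaussianPdf_one_mul_quadratic (A : Matrix (Fin n) (Fin n) ℝ) :
    Integrable fun y : Fin n → ℝ => gaussianPdf n 1 y * (y ⬝ᵥ (A *ᵥ y)) := by
  simp only [gaussianPdf_one_mul_quadratic]
  exact integrable_finsetSum _ fun i _ => integrable_finsetSum _ fun j _ =>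
    (integrable_gaussianPdf_one_mul_mul i j).const_mul _

lemma integral_gaussianPdf_one_mul_quadratic (A : Matrix (Fin n) (Fin n) ℝ) :
    ∫ y : Fin n → ℝ, gaussianPdf n 1 y * (y ⬝ᵥ (A *ᵥ y)) = A.trace := by
  simp only [gaussianPdf_one_mul_quadratic]
  have hint := fun i j : Fin n => (integrable_gaussianPdf_one_mul_mul i j).const_mul (A i j)
  rw [integral_finsetSum _ fun i _ => integrable_finsetSum _ fun j _ => hint i j]
  simp only [integral_finsetSum _ fun j _ => hint _ j, integral_const_mul,
    integral_gaussianPdf_one_mul_mul, one_apply, mul_ite, mul_one, mul_zero, Finset.sum_ite_eq,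
    Finset.mem_univ, if_true, trace, diag]

lemma Matrix.PosDef.exists_mul_transpose {P : Matrix (Fin n) (Fin n) ℝ} (hP : P.PosDef) :
    ∃ B : Matrix (Fin n) (Fin n) ℝ, B.det ≠ 0 ∧ P = B * Bᵀ := by
  classical
  obtain ⟨C, hC⟩ : ∃ C : Matrix (Fin n) (Fin n) ℝ, P = Cᴴ * C := by
    open scoped MatrixOrder Matrix.Norms.L2Operator in
    exact CStarAlgebra.nonneg_iff_eq_star_mul_self.mp hP.posSemidef.nonneg
  refine ⟨Cᵀ, fun h => hP.det_pos.ne' ?_, by simpa using hC⟩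
  rw [hC, det_mul, ← det_transpose C, h, mul_zero]

lemma integrable_and_integral_gaussianPdf_mul_quadratic {P : Matrix (Fin n) (Fin n) ℝ}
    (hP : P.PosDef) (A : Matrix (Fin n) (Fin n) ℝ) :
    Integrable (fun x => gaussianPdf n P x * (x ⬝ᵥ (A *ᵥ x))) ∧
      ∫ x, gaussianPdf n P x * (x ⬝ᵥ (A *ᵥ x)) = (A * P).trace := by
  obtain ⟨B, hB, rfl⟩ := hP.exists_mul_transpose
  have hquad : ∀ y : Fin n → ℝ, (B *ᵥ y) ⬝ᵥ (A *ᵥ (B *ᵥ y)) = y ⬝ᵥ ((Bᵀ * A * B) *ᵥ y) := by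
    intro y
    rw [← mulVec_mulVec, ← mulVec_mulVec, dotProduct_mulVec y, vecMul_transpose]
  refine ⟨integrable_gaussianPdf_mul hB ?_, ?_⟩
  · simpa only [hquad] using integrable_gaussianPdf_one_mul_quadratic (Bᵀ * A * B)
  · rw [integral_gaussianPdf_mul hB]
    simp only [hquad]
    rw [integral_gaussianPdf_one_mul_quadratic, Matrix.mul_assoc, trace_mul_comm,
      Matrix.mul_assoc]

lemma integrable_and_integral_gaussianPdf {P : Matrix (Fin n) (Fin n) ℝ} (hP : P.PosDef) :
    Integrable (gaussianPdf n P) ∧ ∫ x, gaussianPdf n P x = 1 := by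
  obtain ⟨B, hB, rfl⟩ := hP.exists_mul_transpose
  have h1 := integrable_gaussianPdf_mul hB (h := fun _ => 1)
  have h2 := integral_gaussianPdf_mul hB fun _ => 1
  simp only [mul_one] at h1 h2
  exact ⟨h1 integrable_gaussianPdf_one, h2.trans integral_gaussianPdf_one⟩

lemma log_gaussianPdf {P : Matrix (Fin n) (Fin n) ℝ} (hP : P.PosDef) (x : Fin n → ℝ) :
    Real.log (gaussianPdf n P x) = -(n * Real.log (2 * Real.pi) + Real.log P.det) / 2
      - (x ⬝ᵥ (P⁻¹ *ᵥ x)) / 2 := by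
  have hdet := hP.det_pos
  rw [gaussianPdf, Real.log_mul (by positivity) (by positivity), Real.log_inv, Real.log_exp,
    Real.log_sqrt (by positivity), Real.log_mul (by positivity) (by positivity), Real.log_pow]
  ring

lemma relEntropyNats_gaussianMeasure_eq_integral {P Q : Matrix (Fin n) (Fin n) ℝ}
    (hP : P.PosDef) (hQ : Q.PosDef) :
    relEntropyNats (gaussianMeasure n P) (gaussianMeasure n Q)
      = ∫ x, gaussianPdf n P x * (Real.log (gaussianPdf n P x) - Real.log (gaussianPdf n Q x)) := by
  have hmeas := fun Λ : Matrix (Fin n) (Fin n) ℝ =>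
    (continuous_gaussianPdf Λ).measurable.ennreal_ofReal
  have hac : gaussianMeasure n P ≪ (volume : Measure (Fin n → ℝ)) :=
    withDensity_absolutelyContinuous _ _
  have hder : ∀ᵐ x, ((gaussianMeasure n P).rnDeriv (gaussianMeasure n Q) x).toReal
      = gaussianPdf n P x / gaussianPdf n Q x := by
    have : SigmaFinite (gaussianMeasure n P) :=
      SigmaFinite.withDensity_of_ne_top (ae_of_all _ fun _ => ENNReal.ofReal_ne_top)
    filter_upwards [Measure.rnDeriv_withDensity_right_of_absolutelyContinuous hac
      (hmeas Q).aemeasurable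
      (ae_of_all _ fun x => (ENNReal.ofReal_pos.2 (gaussianPdf_pos hQ x)).ne')
      (ae_of_all _ fun _ => ENNReal.ofReal_ne_top),
      Measure.rnDeriv_withDensity volume (hmeas P)] with x hx₁ hx₂
    rw [gaussianMeasure] at hx₁
    rw [gaussianMeasure, gaussianMeasure, hx₁, hx₂, ENNReal.toReal_mul, ENNReal.toReal_inv,
      ENNReal.toReal_ofReal (gaussianPdf_pos hP x).le,
      ENNReal.toReal_ofReal (gaussianPdf_pos hQ x).le, div_eq_inv_mul]
  rw [relEntropyNats, gaussianMeasure, integral_withDensity_eq_integral_toReal_smul (hmeas P)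
    (ae_of_all _ fun _ => ENNReal.ofReal_lt_top), ← gaussianMeasure]
  refine integral_congr_ae ?_
  filter_upwards [hder] with x hx
  rw [hx, ENNReal.toReal_ofReal (gaussianPdf_pos hP x).le, smul_eq_mul,
    Real.log_div (gaussianPdf_pos hP x).ne' (gaussianPdf_pos hQ x).ne']

/-- The relative entropy between nondegenerate centered Gaussian laws. -/
lemma relEntropyNats_gaussianMeasure {P Q : Matrix (Fin n) (Fin n) ℝ}
    (hP : P.PosDef) (hQ : Q.PosDef) :
    relEntropyNats (gaussianMeasure n P) (gaussianMeasure n Q)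
      = 1 / 2 * ((Q⁻¹ * P).trace - n - (Real.log P.det - Real.log Q.det)) := by
  obtain ⟨hi₀, hv₀⟩ := integrable_and_integral_gaussianPdf hP
  obtain ⟨hi₁, hv₁⟩ := integrable_and_integral_gaussianPdf_mul_quadratic hP P⁻¹
  obtain ⟨hi₂, hv₂⟩ := integrable_and_integral_gaussianPdf_mul_quadratic hP Q⁻¹
  have hexpand : ∀ x, gaussianPdf n P x *
      (Real.log (gaussianPdf n P x) - Real.log (gaussianPdf n Q x))
      = ((Real.log Q.det - Real.log P.det) / 2) * gaussianPdf n P x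
        - (1 / 2) * (gaussianPdf n P x * (x ⬝ᵥ (P⁻¹ *ᵥ x)))
        + (1 / 2) * (gaussianPdf n P x * (x ⬝ᵥ (Q⁻¹ *ᵥ x))) := by
    intro x
    rw [log_gaussianPdf hP, log_gaussianPdf hQ]
    ring
  rw [relEntropyNats_gaussianMeasure_eq_integral hP hQ]
  simp only [hexpand]
  have hi : Integrable fun x => (Real.log Q.det - Real.log P.det) / 2 * gaussianPdf n P x
      - 1 / 2 * (gaussianPdf n P x * (x ⬝ᵥ (P⁻¹ *ᵥ x))) :=
    (hi₀.const_mul _).sub (hi₁.const_mul _)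
  rw [integral_add hi (hi₂.const_mul _),
    integral_sub (hi₀.const_mul _) (hi₁.const_mul _), integral_const_mul, integral_const_mul,
    integral_const_mul, hv₀, hv₁, hv₂, nonsing_inv_mul _ hP.det_pos.ne'.isUnit]
  simp only [trace_one, Fintype.card_fin]
  ring

end Gaussian

section Fourier

lemma abs_mul_cos_le (a t : ℝ) : |a * Real.cos t| ≤ |a| := by
  rw [abs_mul]
  exact mul_le_of_le_one_right (abs_nonneg a) (Real.abs_cos_le_one t)

lemma integral_cos_two_pi_mul_int (m : ℤ) :
    ∫ θ in (0 : ℝ)..1, Real.cos (2 * Real.pi * θ * m) = if m = 0 then 1 else 0 := by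
  split_ifs with hm
  · simp [hm]
  · have hne : 2 * Real.pi * m ≠ 0 := by
      have : (m : ℝ) ≠ 0 := mod_cast hm
      positivity
    have hfun : (fun θ : ℝ => Real.cos (2 * Real.pi * θ * m))
        = fun θ => Real.cos (2 * Real.pi * m * θ) := by
      ext θ; ring_nf
    have hsin : Real.sin (2 * Real.pi * m) = 0 := by
      rw [show 2 * Real.pi * m = ((2 * m : ℤ) : ℝ) * Real.pi by push_cast; ring]
      exact Real.sin_int_mul_pi _
    rw [hfun, intervalIntegral.integral_comp_mul_left _ hne]
    simp [hsin]

lemma integral_cos_mul_cos_int (k m : ℤ) :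
    ∫ θ in (0 : ℝ)..1, Real.cos (2 * Real.pi * θ * k) * Real.cos (2 * Real.pi * θ * m)
      = ((if k = m then 1 else 0) + (if k = -m then 1 else 0)) / 2 := by
  have hfun : (fun θ : ℝ => Real.cos (2 * Real.pi * θ * k) * Real.cos (2 * Real.pi * θ * m))
      = fun θ => (Real.cos (2 * Real.pi * θ * (k - m : ℤ))
        + Real.cos (2 * Real.pi * θ * (k + m : ℤ))) / 2 := by
    ext θ
    push_cast
    rw [mul_sub, mul_add, Real.cos_sub, Real.cos_add]
    ring
  have hint : ∀ l : ℤ, IntervalIntegrable (fun θ : ℝ => Real.cos (2 * Real.pi * θ * l))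
      volume 0 1 := fun l => Continuous.intervalIntegrable (by fun_prop) _ _
  rw [hfun, intervalIntegral.integral_div, intervalIntegral.integral_add (hint _) (hint _),
    integral_cos_two_pi_mul_int, integral_cos_two_pi_mul_int]
  simp only [sub_eq_zero, add_eq_zero_iff_eq_neg]

variable {K : ℤ → ℝ}

lemma summable_mul_cos (hK : Summable fun m => |K m|) (u : ℤ → ℝ) :
    Summable fun m => K m * Real.cos (u m) :=
  .of_norm_bounded hK fun _ => abs_mul_cos_le _ _

lemma continuous_spectrum' (hK : Summable fun m => |K m|) : Continuous (spectrum' K) :=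
  continuous_tsum (fun _ => by fun_prop) hK fun _ _ => abs_mul_cos_le _ _

lemma abs_spectrum'_le (hK : Summable fun m => |K m|) (θ : ℝ) :
    |spectrum' K θ| ≤ ∑' m, |K m| := by
  rw [← Real.norm_eq_abs, spectrum']
  exact tsum_of_norm_bounded hK.hasSum fun _ => abs_mul_cos_le _ _

/-- Fourier inversion for an even, absolutely summable sequence. -/
lemma integral_spectrum'_mul_cos (hKe : ∀ m, K (-m) = K m) (hK : Summable fun m => |K m|)
    (m : ℤ) : ∫ θ in (0 : ℝ)..1, spectrum' K θ * Real.cos (2 * Real.pi * θ * m) = K m := by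
  have hsum : HasSum (fun k : ℤ => ∫ θ in (0 : ℝ)..1,
      K k * Real.cos (2 * Real.pi * θ * k) * Real.cos (2 * Real.pi * θ * m))
      (∫ θ in (0 : ℝ)..1, spectrum' K θ * Real.cos (2 * Real.pi * θ * m)) := by
    refine intervalIntegral.hasSum_integral_of_dominated_convergence (fun k _ => |K k|)
      (fun k => Continuous.aestronglyMeasurable (by fun_prop))
      (fun k => ae_of_all _ fun θ _ => (abs_mul_cos_le _ _).trans (abs_mul_cos_le _ _))
      (ae_of_all _ fun _ _ => hK) (by simp) (ae_of_all _ fun θ _ => ?_)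
    exact (summable_mul_cos hK _).hasSum.mul_right _
  rw [← hsum.tsum_eq]
  simp only [mul_assoc (K _), intervalIntegral.integral_const_mul, integral_cos_mul_cos_int]
  have hfun : (fun k : ℤ => K k * (((if k = m then 1 else 0) + (if k = -m then 1 else 0)) / 2))
      = fun k => (if k = m then K m / 2 else 0) + (if k = -m then K m / 2 else 0) := by
    ext k
    by_cases h₁ : k = m <;> by_cases h₂ : k = -m <;> simp only [h₁, h₂, if_true, if_false] <;>
      grind
  rw [hfun, Summable.tsum_add (summable_of_hasFiniteSupport ?_) (summable_of_hasFiniteSupport ?_),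
    tsum_ite_eq, tsum_ite_eq, add_halves]
  · exact (Set.finite_singleton m).subset fun k hk => by by_contra h; simp_all
  · exact (Set.finite_singleton (-m)).subset fun k hk => by by_contra h; simp_all

/-- The vector with entries `cos (2πθj + α)`. -/
noncomputable def cosVec (n : ℕ) (α θ : ℝ) : Fin n → ℝ :=
  fun j => Real.cos (2 * Real.pi * θ * j + α)

/-- The energy `|∑ j, x j e^{2πiθj}|²` of a real vector `x` at frequency `θ`. -/
noncomputable def fourierEnergy {n : ℕ} (x : Fin n → ℝ) (θ : ℝ) : ℝ :=
  (x ⬝ᵥ cosVec n 0 θ) ^ 2 + (x ⬝ᵥ cosVec n (Real.pi / 2) θ) ^ 2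

variable {n : ℕ}

lemma fourierEnergy_nonneg (x : Fin n → ℝ) (θ : ℝ) : 0 ≤ fourierEnergy x θ := by
  unfold fourierEnergy
  positivity

lemma continuous_fourierEnergy (x : Fin n → ℝ) : Continuous (fourierEnergy x) := by
  unfold fourierEnergy cosVec dotProduct
  fun_prop

lemma cosVec_dotProduct_self_add (n : ℕ) (θ : ℝ) :
    cosVec n 0 θ ⬝ᵥ cosVec n 0 θ + cosVec n (Real.pi / 2) θ ⬝ᵥ cosVec n (Real.pi / 2) θ = n := by
  simp only [dotProduct, cosVec, ← Finset.sum_add_distrib, Real.cos_add_pi_div_two, add_zero,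
    ← sq]
  simp

lemma fourierEnergy_eq_sum (x : Fin n → ℝ) (θ : ℝ) :
    fourierEnergy x θ
      = ∑ i, ∑ j, x i * x j * Real.cos (2 * Real.pi * θ * ((i : ℤ) - (j : ℤ) : ℤ)) := by
  simp only [fourierEnergy, dotProduct, cosVec, sq, Finset.sum_mul_sum,
    ← Finset.sum_add_distrib]
  refine Finset.sum_congr rfl fun i _ => Finset.sum_congr rfl fun j _ => ?_
  push_cast
  rw [Real.cos_add_pi_div_two, Real.cos_add_pi_div_two, mul_sub, Real.cos_sub, add_zero, add_zero]
  ring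

lemma integral_spectrum'_mul_fourierEnergy (hKe : ∀ m, K (-m) = K m)
    (hK : Summable fun m => |K m|) (x : Fin n → ℝ) :
    ∫ θ in (0 : ℝ)..1, spectrum' K θ * fourierEnergy x θ = x ⬝ᵥ (toeplitz K n *ᵥ x) := by
  have hS := continuous_spectrum' hK
  simp only [fourierEnergy_eq_sum, Finset.mul_sum, mul_left_comm (spectrum' K _)]
  rw [intervalIntegral.integral_finsetSum fun i _ =>
    Continuous.intervalIntegrable (by fun_prop) _ _]
  simp only [dotProduct, mulVec, Finset.mul_sum]
  refine Finset.sum_congr rfl fun i _ => ?_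
  rw [intervalIntegral.integral_finsetSum fun j _ =>
    Continuous.intervalIntegrable (by fun_prop) _ _]
  refine Finset.sum_congr rfl fun j _ => ?_
  rw [intervalIntegral.integral_const_mul, integral_spectrum'_mul_cos hKe hK, toeplitz]
  ring

lemma spectrum'_single (θ : ℝ) : spectrum' (Pi.single 0 1) θ = 1 := by
  rw [spectrum', tsum_eq_single 0 fun m hm => by simp [hm]]
  simp

lemma toeplitz_single (n : ℕ) : toeplitz (Pi.single 0 1) n = 1 := by
  ext i j
  simp only [toeplitz, Pi.single_apply, sub_eq_zero, one_apply, Nat.cast_inj, Fin.ext_iff]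

lemma even_single (m : ℤ) :
    (Pi.single 0 1 : ℤ → ℝ) (-m) = (Pi.single 0 1 : ℤ → ℝ) m := by
  simp [Pi.single_apply]

lemma summable_abs_single : Summable fun m : ℤ => |(Pi.single 0 1 : ℤ → ℝ) m| :=
  summable_of_hasFiniteSupport <| (Set.finite_singleton 0).subset fun m hm => by
    by_contra h
    simp_all

lemma integral_fourierEnergy (x : Fin n → ℝ) :
    ∫ θ in (0 : ℝ)..1, fourierEnergy x θ = x ⬝ᵥ x := by
  simpa [spectrum'_single, toeplitz_single] using
    integral_spectrum'_mul_fourierEnergy even_single summable_abs_single x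

lemma isHermitian_toeplitz (hKe : ∀ m, K (-m) = K m) (n : ℕ) : (toeplitz K n).IsHermitian := by
  ext i j
  simp only [conjTranspose_apply, toeplitz, star_trivial]
  rw [← hKe, neg_sub]

lemma mul_dotProduct_self_le_toeplitz (hKe : ∀ m, K (-m) = K m) (hK : Summable fun m => |K m|)
    {c : ℝ} (hc : ∀ θ ∈ Set.Icc (0 : ℝ) 1, c ≤ spectrum' K θ) (x : Fin n → ℝ) :
    c * (x ⬝ᵥ x) ≤ x ⬝ᵥ (toeplitz K n *ᵥ x) := by
  rw [← integral_spectrum'_mul_fourierEnergy hKe hK, ← integral_fourierEnergy,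
    ← intervalIntegral.integral_const_mul]
  have hE := continuous_fourierEnergy x
  have hS := continuous_spectrum' hK
  exact intervalIntegral.integral_mono_on zero_le_one
    (Continuous.intervalIntegrable (by fun_prop) _ _)
    (Continuous.intervalIntegrable (by fun_prop) _ _)
    fun θ hθ => mul_le_mul_of_nonneg_right (hc θ hθ) (fourierEnergy_nonneg x θ)

lemma posDef_toeplitz (hKe : ∀ m, K (-m) = K m) (hK : Summable fun m => |K m|)
    {c : ℝ} (hc₀ : 0 < c) (hc : ∀ θ ∈ Set.Icc (0 : ℝ) 1, c ≤ spectrum' K θ) (n : ℕ) :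
    (toeplitz K n).PosDef := by
  refine .of_dotProduct_mulVec_pos (isHermitian_toeplitz hKe n) fun x hx => ?_
  rw [star_trivial]
  refine lt_of_lt_of_le (mul_pos hc₀ ?_) (mul_dotProduct_self_le_toeplitz hKe hK hc x)
  simpa using dotProduct_star_self_pos_iff.2 hx

end Fourier

section ApproximateEigenvectors

variable {K : ℤ → ℝ}

/-- The part of `∑ m, |K m|` that row `j` of the `n × n` Toeplitz matrix of `K` misses. -/
noncomputable def truncationTail (K : ℤ → ℝ) (n : ℕ) (j : Fin n) : ℝ :=
  ∑' m : ℤ, if 0 ≤ (j : ℤ) - m ∧ (j : ℤ) - m < n then 0 else |K m|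

lemma summable_truncationTail (hK : Summable fun m => |K m|) (n : ℕ) (j : Fin n) :
    Summable fun m : ℤ => if 0 ≤ (j : ℤ) - m ∧ (j : ℤ) - m < n then 0 else |K m| := by
  refine .of_nonneg_of_le (fun m => ?_) (fun m => ?_) hK <;> split_ifs <;> simp

lemma truncationTail_le (hK : Summable fun m => |K m|) (n : ℕ) (j : Fin n) :
    truncationTail K n j ≤ ∑' m, |K m| :=
  (summable_truncationTail hK n j).tsum_le_tsum (fun m => by split_ifs <;> simp) hK

lemma tsum_mul_sin_eq_zero (hKe : ∀ m, K (-m) = K m) (θ : ℝ) :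
    ∑' m : ℤ, K m * Real.sin (2 * Real.pi * θ * m) = 0 := by
  have h := (Equiv.neg ℤ).tsum_eq fun m : ℤ => K m * Real.sin (2 * Real.pi * θ * m)
  simp only [Equiv.neg_apply, hKe, Int.cast_neg, mul_neg, Real.sin_neg, tsum_neg] at h
  linarith

lemma tsum_mul_cos_sub (hKe : ∀ m, K (-m) = K m) (hK : Summable fun m => |K m|) (α θ t : ℝ) :
    ∑' m : ℤ, K m * Real.cos (2 * Real.pi * θ * (t - m) + α)
      = spectrum' K θ * Real.cos (2 * Real.pi * θ * t + α) := by
  have hsin : Summable fun m : ℤ => K m * Real.sin (2 * Real.pi * θ * m) := by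
    simpa only [Real.cos_sub_pi_div_two] using
      summable_mul_cos hK fun m => 2 * Real.pi * θ * m - Real.pi / 2
  have hfun : (fun m : ℤ => K m * Real.cos (2 * Real.pi * θ * (t - m) + α))
      = fun m : ℤ => K m * Real.cos (2 * Real.pi * θ * m) * Real.cos (2 * Real.pi * θ * t + α)
        + K m * Real.sin (2 * Real.pi * θ * m) * Real.sin (2 * Real.pi * θ * t + α) := by
    ext m
    rw [show 2 * Real.pi * θ * (t - m) + α
        = (2 * Real.pi * θ * t + α) - 2 * Real.pi * θ * m by ring,
      Real.cos_sub]
    ring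
  rw [hfun, ((summable_mul_cos hK _).mul_right _).tsum_add (hsin.mul_right _), tsum_mul_right,
    tsum_mul_right, tsum_mul_sin_eq_zero hKe, zero_mul, add_zero, spectrum']

lemma toeplitz_mulVec_eq_tsum {n : ℕ} (u : ℤ → ℝ) (j : Fin n) :
    (toeplitz K n *ᵥ fun k => u k) j
      = ∑' m : ℤ, if 0 ≤ (j : ℤ) - m ∧ (j : ℤ) - m < n then K m * u (j - m) else 0 := by
  have hinj : Function.Injective fun k : Fin n => (j : ℤ) - k := fun a b h => by
    simp only [sub_right_inj, Nat.cast_inj] at h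
    exact Fin.ext h
  have hsupp : Function.support (fun m : ℤ =>
      if 0 ≤ (j : ℤ) - m ∧ (j : ℤ) - m < n then K m * u (j - m) else 0)
      ⊆ Set.range fun k : Fin n => (j : ℤ) - k := fun m hm => by
    have h : 0 ≤ (j : ℤ) - m ∧ (j : ℤ) - m < n := by
      by_contra h
      exact hm (if_neg h)
    exact ⟨⟨((j : ℤ) - m).toNat, by omega⟩, by simp only; omega⟩
  refine Eq.trans ?_ (hinj.tsum_eq hsupp)
  rw [tsum_fintype]
  simp only [mulVec, dotProduct]
  refine Finset.sum_congr rfl fun k _ => ?_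
  have := k.2
  rw [if_pos ⟨by omega, by omega⟩, sub_sub_cancel]
  rfl

/-- Sampled cosines are approximate eigenvectors of a Toeplitz matrix. -/
lemma abs_toeplitz_mulVec_cosVec_sub_le (hKe : ∀ m, K (-m) = K m)
    (hK : Summable fun m => |K m|) (n : ℕ) (α θ : ℝ) (j : Fin n) :
    |(toeplitz K n *ᵥ cosVec n α θ - spectrum' K θ • cosVec n α θ) j|
      ≤ truncationTail K n j := by
  have hrow := toeplitz_mulVec_eq_tsum (K := K) (n := n)
    (fun k => Real.cos (2 * Real.pi * θ * k + α)) j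
  simp only [Int.cast_natCast, Int.cast_sub] at hrow
  have hsum := summable_mul_cos hK fun m => 2 * Real.pi * θ * ((j : ℕ) - m) + α
  have hpart : Summable fun m : ℤ => if 0 ≤ (j : ℤ) - m ∧ (j : ℤ) - m < n then
      K m * Real.cos (2 * Real.pi * θ * ((j : ℕ) - m) + α) else 0 := by
    refine .of_norm_bounded hK fun m => ?_
    split_ifs
    · exact abs_mul_cos_le _ _
    · simp
  have hdiff : (toeplitz K n *ᵥ cosVec n α θ - spectrum' K θ • cosVec n α θ) j
      = ∑' m : ℤ, ((if 0 ≤ (j : ℤ) - m ∧ (j : ℤ) - m < n then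
          K m * Real.cos (2 * Real.pi * θ * ((j : ℕ) - m) + α) else 0)
        - K m * Real.cos (2 * Real.pi * θ * ((j : ℕ) - m) + α)) := by
    rw [hpart.tsum_sub hsum, ← hrow, tsum_mul_cos_sub hKe hK]
    rfl
  rw [hdiff, ← Real.norm_eq_abs]
  refine tsum_of_norm_bounded (summable_truncationTail hK n j).hasSum fun m => ?_
  split_ifs
  · simp
  · simpa using abs_mul_cos_le _ _

lemma card_truncated_le (n : ℕ) (m : ℤ) :
    (Finset.univ.filter fun j : Fin n => ¬(0 ≤ (j : ℤ) - m ∧ (j : ℤ) - m < n)).card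
      ≤ m.natAbs := by
  rw [← Finset.card_range m.natAbs]
  refine Finset.card_le_card_of_injOn
    (fun j : Fin n => if 0 ≤ m then (j : ℕ) else n - 1 - j) (fun j hj => ?_) fun a _ b _ h => ?_
  · have := j.2
    simp only [Finset.coe_filter, Finset.mem_univ, true_and, Set.mem_ofPred_eq] at hj
    simp only [Finset.coe_range, Set.mem_Iio]
    split_ifs <;> omega
  · have ha := a.2
    have hb := b.2
    ext
    simp only at h
    split_ifs at h <;> omega

lemma sum_truncationTail (hK : Summable fun m => |K m|) (n : ℕ) :
    ∑ j, truncationTail K n j = ∑' m : ℤ,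
      (Finset.univ.filter fun j : Fin n => ¬(0 ≤ (j : ℤ) - m ∧ (j : ℤ) - m < n)).card * |K m| := by
  simp only [truncationTail]
  rw [← Summable.tsum_finsetSum fun j _ => summable_truncationTail hK n j]
  refine tsum_congr fun m => ?_
  rw [← nsmul_eq_mul, ← Finset.sum_const, Finset.sum_filter]
  exact Finset.sum_congr rfl fun j _ => by split_ifs <;> tauto

lemma tendsto_sum_truncationTail_div (hK : Summable fun m => |K m|) :
    Tendsto (fun n : ℕ => (∑ j, truncationTail K n j) / n) atTop (nhds 0) := by
  simp only [sum_truncationTail hK, ← tsum_div_const]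
  rw [show nhds (0 : ℝ) = nhds (∑' _ : ℤ, (0 : ℝ)) by rw [tsum_zero]]
  refine tendsto_tsum_of_dominated_convergence hK (fun m => ?_) (Eventually.of_forall fun n m => ?_)
  · have hlim : Tendsto (fun n : ℕ => (m.natAbs * |K m| : ℝ) / n) atTop (nhds 0) :=
      tendsto_const_div_atTop_nhds_zero_nat _
    refine squeeze_zero (fun n => by positivity) (fun n => ?_) hlim
    gcongr
    exact card_truncated_le n m
  · rw [Real.norm_of_nonneg (by positivity)]
    refine div_le_of_le_mul₀ (by positivity) (by positivity) ?_
    rw [mul_comm |K m|]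
    gcongr
    exact (Finset.card_le_univ _).trans_eq (Fintype.card_fin n)

lemma sum_sq_toeplitz_mulVec_cosVec_sub_le (hKe : ∀ m, K (-m) = K m)
    (hK : Summable fun m => |K m|) (n : ℕ) (α θ : ℝ) :
    ∑ j, (toeplitz K n *ᵥ cosVec n α θ - spectrum' K θ • cosVec n α θ) j ^ 2
      ≤ (∑' m, |K m|) * ∑ j, truncationTail K n j := by
  rw [Finset.mul_sum]
  refine Finset.sum_le_sum fun j _ => ?_
  rw [← sq_abs, sq]
  exact mul_le_mul
    ((abs_toeplitz_mulVec_cosVec_sub_le hKe hK n α θ j).trans (truncationTail_le hK n j))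
    (abs_toeplitz_mulVec_cosVec_sub_le hKe hK n α θ j) (abs_nonneg _)
    (tsum_nonneg fun _ => abs_nonneg _)

end ApproximateEigenvectors

section Eigenvectors

variable {n : ℕ} {A : Matrix (Fin n) (Fin n) ℝ}

/-- The coordinates of the `i`-th vector of an orthonormal eigenbasis of a symmetric matrix. -/
noncomputable def Matrix.IsHermitian.eigenvec (hA : A.IsHermitian) (i : Fin n) : Fin n → ℝ :=
  (hA.eigenvectorBasis i).ofLp

lemma sum_sq_eigenvec_dotProduct (hA : A.IsHermitian) (x : Fin n → ℝ) :
    ∑ i, (hA.eigenvec i ⬝ᵥ x) ^ 2 = x ⬝ᵥ x := by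
  have h := hA.eigenvectorBasis.sum_sq_inner_right (WithLp.toLp 2 x)
  rw [← real_inner_self_eq_norm_sq] at h
  simp only [EuclideanSpace.inner_eq_star_dotProduct, star_trivial, dotProduct_comm x] at h
  exact h

lemma eigenvec_dotProduct_self (hA : A.IsHermitian) (i : Fin n) :
    hA.eigenvec i ⬝ᵥ hA.eigenvec i = 1 := by
  have h := real_inner_self_eq_norm_sq (hA.eigenvectorBasis i)
  rw [hA.eigenvectorBasis.norm_eq_one, one_pow, EuclideanSpace.inner_eq_star_dotProduct] at h
  rwa [star_trivial] at h

lemma mulVec_eigenvec (hA : A.IsHermitian) (i : Fin n) :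
    A *ᵥ hA.eigenvec i = hA.eigenvalues i • hA.eigenvec i :=
  hA.mulVec_eigenvectorBasis i

lemma dotProduct_mulVec_of_isHermitian (hA : A.IsHermitian) (x y : Fin n → ℝ) :
    x ⬝ᵥ (A *ᵥ y) = (A *ᵥ x) ⬝ᵥ y := by
  rw [dotProduct_mulVec, ← mulVec_transpose, ← conjTranspose_eq_transpose_of_trivial, hA.eq]

lemma eigenvec_dotProduct_mulVec_sub (hA : A.IsHermitian) (i : Fin n) (g : ℝ) (x : Fin n → ℝ) :
    hA.eigenvec i ⬝ᵥ (A *ᵥ x - g • x) = (hA.eigenvalues i - g) * (hA.eigenvec i ⬝ᵥ x) := by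
  rw [dotProduct_sub, dotProduct_mulVec_of_isHermitian hA, mulVec_eigenvec, smul_dotProduct,
    dotProduct_smul, smul_eq_mul, smul_eq_mul, sub_mul]

lemma sum_eigenvalues_sub_sq_mul (hA : A.IsHermitian) (g : ℝ) (x : Fin n → ℝ) :
    ∑ i, (hA.eigenvalues i - g) ^ 2 * (hA.eigenvec i ⬝ᵥ x) ^ 2
      = ∑ j, (A *ᵥ x - g • x) j ^ 2 := by
  simp only [← mul_pow, ← eigenvec_dotProduct_mulVec_sub, sum_sq_eigenvec_dotProduct]
  simp only [dotProduct, sq]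

lemma le_eigenvalues (hA : A.IsHermitian) {c : ℝ} (hc : ∀ x, c * (x ⬝ᵥ x) ≤ x ⬝ᵥ (A *ᵥ x))
    (i : Fin n) : c ≤ hA.eigenvalues i := by
  simpa [mulVec_eigenvec, eigenvec_dotProduct_self] using hc (hA.eigenvec i)

lemma sum_eigenvec_dotProduct_mulVec (hA : A.IsHermitian) (M : Matrix (Fin n) (Fin n) ℝ) :
    ∑ i, hA.eigenvec i ⬝ᵥ (M *ᵥ hA.eigenvec i) = M.trace := by
  let U : Matrix (Fin n) (Fin n) ℝ := ↑hA.eigenvectorUnitary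
  have hUU : U * Uᵀ = 1 := by
    rw [← conjTranspose_eq_transpose_of_trivial, ← star_eq_conjTranspose]
    exact Unitary.coe_mul_star_self _
  calc ∑ i, hA.eigenvec i ⬝ᵥ (M *ᵥ hA.eigenvec i) = (Uᵀ * (M * U)).trace := rfl
    _ = M.trace := by rw [trace_mul_comm, mul_assoc, hUU, mul_one]

lemma trace_inv_mul_eq_sum (hA : A.IsHermitian) (h₀ : ∀ i, hA.eigenvalues i ≠ 0)
    (F : Matrix (Fin n) (Fin n) ℝ) :
    (A⁻¹ * F).trace
      = ∑ i, (hA.eigenvalues i)⁻¹ * (hA.eigenvec i ⬝ᵥ (F *ᵥ hA.eigenvec i)) := by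
  have hdet : IsUnit A.det := by
    rw [hA.det_eq_prod_eigenvalues, isUnit_iff_ne_zero]
    simpa [Finset.prod_ne_zero_iff] using h₀
  have hinv : ∀ i, A⁻¹ *ᵥ hA.eigenvec i = (hA.eigenvalues i)⁻¹ • hA.eigenvec i := fun i => by
    have h := congrArg (fun x => (hA.eigenvalues i)⁻¹ • (A⁻¹ *ᵥ x)) (mulVec_eigenvec hA i)
    simp only [mulVec_mulVec, nonsing_inv_mul A hdet, one_mulVec, mulVec_smul, smul_smul,
      inv_mul_cancel₀ (h₀ i), one_smul] at h
    exact h.symm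
  rw [← sum_eigenvec_dotProduct_mulVec hA]
  refine Finset.sum_congr rfl fun i _ => ?_
  rw [← mulVec_mulVec, dotProduct_mulVec_of_isHermitian hA.inv, hinv, smul_dotProduct,
    smul_eq_mul]

lemma log_det_eq_sum (hA : A.IsHermitian) (h₀ : ∀ i, hA.eigenvalues i ≠ 0) :
    Real.log A.det = ∑ i, Real.log (hA.eigenvalues i) := by
  rw [hA.det_eq_prod_eigenvalues, ← Real.log_prod fun i _ => by simpa using h₀ i]
  simp

lemma sum_fourierEnergy_eigenvec (hA : A.IsHermitian) (θ : ℝ) :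
    ∑ i, fourierEnergy (hA.eigenvec i) θ = n := by
  simp only [fourierEnergy, Finset.sum_add_distrib, sum_sq_eigenvec_dotProduct,
    cosVec_dotProduct_self_add]

end Eigenvectors

section SpectralLimit

variable {K : ℤ → ℝ}

lemma sum_fourierEnergy_mul_sq_le (hKe : ∀ m, K (-m) = K m) (hK : Summable fun m => |K m|)
    {n : ℕ} (hA : (toeplitz K n).IsHermitian) (θ : ℝ) :
    ∑ i, fourierEnergy (hA.eigenvec i) θ * (hA.eigenvalues i - spectrum' K θ) ^ 2
      ≤ 2 * ((∑' m, |K m|) * ∑ j, truncationTail K n j) := by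
  have h₀ := sum_sq_toeplitz_mulVec_cosVec_sub_le hKe hK n 0 θ
  have h₁ := sum_sq_toeplitz_mulVec_cosVec_sub_le hKe hK n (Real.pi / 2) θ
  rw [← sum_eigenvalues_sub_sq_mul hA] at h₀ h₁
  simp only [fourierEnergy, mul_comm (_ + _), mul_add, Finset.sum_add_distrib]
  linarith

/-- The averaged distance between eigenvalues and spectrum, weighted by the energy of the
eigenvectors at frequency `θ`, is small uniformly in `θ`. -/
lemma sum_fourierEnergy_mul_abs_div_le (hKe : ∀ m, K (-m) = K m)
    (hK : Summable fun m => |K m|) {n : ℕ} (hA : (toeplitz K n).IsHermitian) (θ : ℝ) :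
    (∑ i, fourierEnergy (hA.eigenvec i) θ * |hA.eigenvalues i - spectrum' K θ|) / n
      ≤ √(2 * (∑' m, |K m|) * ((∑ j, truncationTail K n j) / n)) := by
  refine Real.le_sqrt_of_sq_le ?_
  have hCS := Finset.sum_sq_le_sum_mul_sum_of_sq_le_mul Finset.univ
    (r := fun i => fourierEnergy (hA.eigenvec i) θ * |hA.eigenvalues i - spectrum' K θ|)
    (f := fun i => fourierEnergy (hA.eigenvec i) θ)
    (g := fun i => fourierEnergy (hA.eigenvec i) θ * (hA.eigenvalues i - spectrum' K θ) ^ 2)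
    (fun i _ => fourierEnergy_nonneg _ _)
    (fun i _ => mul_nonneg (fourierEnergy_nonneg _ _) (sq_nonneg _))
    (fun i _ => by rw [mul_pow, sq_abs]; exact le_of_eq (by ring))
  rw [sum_fourierEnergy_eigenvec] at hCS
  have h := hCS.trans (mul_le_mul_of_nonneg_left (sum_fourierEnergy_mul_sq_le hKe hK hA θ)
    n.cast_nonneg)
  rcases n.eq_zero_or_pos with rfl | hn
  · simp
  · have hn' : (0 : ℝ) < n := mod_cast hn
    rw [div_pow, div_le_iff₀ (by positivity)]
    refine h.trans_eq ?_
    field_simp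

/-- **Szegő-type limit**: the averages `n⁻¹ ∑ i, φ (λ i) ⟪v i, T v i⟫` over an eigenbasis of
the Toeplitz matrix of `K`, where `T` is the Toeplitz matrix of `L`, converge to
`∫ S_L φ(S_K)`. -/
lemma tendsto_sum_eigenvalues_mul_toeplitz {L : ℤ → ℝ} (hKe : ∀ m, K (-m) = K m)
    (hK : Summable fun m => |K m|) (hLe : ∀ m, L (-m) = L m) (hL : Summable fun m => |L m|)
    {c : ℝ} (hc : ∀ θ ∈ Set.Icc (0 : ℝ) 1, c ≤ spectrum' K θ) {φ : ℝ → ℝ} {B : ℝ} (hB : 0 ≤ B)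
    (hφ : ∀ x y, c ≤ x → c ≤ y → |φ x - φ y| ≤ B * |x - y|)
    (hA : ∀ n, (toeplitz K n).IsHermitian) :
    Tendsto (fun n : ℕ => (∑ i, φ ((hA n).eigenvalues i)
        * ((hA n).eigenvec i ⬝ᵥ (toeplitz L n *ᵥ (hA n).eigenvec i))) / n) atTop
      (nhds (∫ θ in (0 : ℝ)..1, spectrum' L θ * φ (spectrum' K θ))) := by
  have hSL := continuous_spectrum' hL
  have hSK := continuous_spectrum' hK
  have hφc : ContinuousOn φ (Set.Ici c) :=
    (LipschitzOnWith.of_dist_le_mul (K := ⟨B, hB⟩) fun x hx y hy => hφ x y hx hy).continuousOn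
  have hint : IntervalIntegrable (fun θ => spectrum' L θ * φ (spectrum' K θ)) volume 0 1 := by
    refine ContinuousOn.intervalIntegrable ?_
    rw [Set.uIcc_of_le zero_le_one]
    exact hSL.continuousOn.mul (hφc.comp hSK.continuousOn hc)
  have hbound : ∀ n : ℕ, n ≠ 0 → ‖(∑ i, φ ((hA n).eigenvalues i)
        * ((hA n).eigenvec i ⬝ᵥ (toeplitz L n *ᵥ (hA n).eigenvec i))) / n
      - ∫ θ in (0 : ℝ)..1, spectrum' L θ * φ (spectrum' K θ)‖
      ≤ (∑' m, |L m|) * (B * √(2 * (∑' m, |K m|) * ((∑ j, truncationTail K n j) / n))) := by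
    intro n hn
    have hn' : (n : ℝ) ≠ 0 := mod_cast hn
    have hE := fun i => continuous_fourierEnergy ((hA n).eigenvec i)
    have hsum : (∑ i, φ ((hA n).eigenvalues i)
        * ((hA n).eigenvec i ⬝ᵥ (toeplitz L n *ᵥ (hA n).eigenvec i))) / n
        = ∫ θ in (0 : ℝ)..1, (∑ i, φ ((hA n).eigenvalues i)
          * (spectrum' L θ * fourierEnergy ((hA n).eigenvec i) θ)) / n := by
      rw [intervalIntegral.integral_div, intervalIntegral.integral_finsetSum fun i _ =>
        Continuous.intervalIntegrable (by fun_prop) _ _]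
      simp only [intervalIntegral.integral_const_mul,
        integral_spectrum'_mul_fourierEnergy hLe hL]
    rw [hsum, ← intervalIntegral.integral_sub
      (Continuous.intervalIntegrable (by fun_prop) _ _) hint]
    refine (intervalIntegral.norm_integral_le_of_norm_le_const fun θ hθ => ?_).trans_eq
      (by rw [sub_zero, abs_one, mul_one])
    have hθ' : θ ∈ Set.Icc (0 : ℝ) 1 := by
      rw [Set.uIoc_of_le zero_le_one] at hθ
      exact Set.Ioc_subset_Icc_self hθ
    have heq : (∑ i, φ ((hA n).eigenvalues i)
          * (spectrum' L θ * fourierEnergy ((hA n).eigenvec i) θ)) / n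
          - spectrum' L θ * φ (spectrum' K θ)
        = spectrum' L θ * ((∑ i, fourierEnergy ((hA n).eigenvec i) θ
          * (φ ((hA n).eigenvalues i) - φ (spectrum' K θ))) / n) := by
      simp only [mul_sub, Finset.sum_sub_distrib, ← Finset.sum_mul, sum_fourierEnergy_eigenvec,
        sub_div, mul_div_cancel_left₀ _ hn', Finset.mul_sum, mul_div_assoc', mul_sub]
      congr 2
      exact Finset.sum_congr rfl fun i _ => by ring
    rw [heq, norm_mul]
    refine mul_le_mul (abs_spectrum'_le hL θ) ?_ (norm_nonneg _)
      (tsum_nonneg fun _ => abs_nonneg _)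
    rw [Real.norm_eq_abs, abs_div, Nat.abs_cast]
    refine le_trans ?_ (mul_le_mul_of_nonneg_left
      (sum_fourierEnergy_mul_abs_div_le hKe hK (hA n) θ) hB)
    rw [← mul_div_assoc, Finset.mul_sum]
    gcongr
    refine (Finset.abs_sum_le_sum_abs _ _).trans (Finset.sum_le_sum fun i _ => ?_)
    rw [abs_mul, abs_of_nonneg (fourierEnergy_nonneg _ _), mul_left_comm]
    exact mul_le_mul_of_nonneg_left (hφ _ _ (le_eigenvalues _
      (mul_dotProduct_self_le_toeplitz hKe hK hc) i) (hc θ hθ')) (fourierEnergy_nonneg _ _)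
  rw [tendsto_iff_norm_sub_tendsto_zero]
  refine squeeze_zero' (Eventually.of_forall fun n => norm_nonneg _)
    ((eventually_ne_atTop 0).mono hbound) ?_
  have hlim := ((((tendsto_sum_truncationTail_div hK).const_mul
    (2 * ∑' m, |K m|)).sqrt).const_mul B).const_mul (∑' m, |L m|)
  simpa using hlim

lemma abs_log_sub_log_le {c x y : ℝ} (hc : 0 < c) (hx : c ≤ x) (hy : c ≤ y) :
    |Real.log x - Real.log y| ≤ c⁻¹ * |x - y| := by
  have key : ∀ {x y : ℝ}, c ≤ x → c ≤ y → Real.log x - Real.log y ≤ c⁻¹ * |x - y| := by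
    intro x y hx hy
    have hx₀ := hc.trans_le hx
    have hy₀ := hc.trans_le hy
    rw [← Real.log_div hx₀.ne' hy₀.ne']
    calc Real.log (x / y) ≤ x / y - 1 := Real.log_le_sub_one_of_pos (div_pos hx₀ hy₀)
      _ = y⁻¹ * (x - y) := by field_simp
      _ ≤ y⁻¹ * |x - y| := by gcongr; exact le_abs_self _
      _ ≤ c⁻¹ * |x - y| := by gcongr
  exact abs_sub_le_iff.2 ⟨key hx hy, abs_sub_comm x y ▸ key hy hx⟩

lemma abs_inv_sub_inv_le {c x y : ℝ} (hc : 0 < c) (hx : c ≤ x) (hy : c ≤ y) :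
    |x⁻¹ - y⁻¹| ≤ (c * c)⁻¹ * |x - y| := by
  have hx₀ := hc.trans_le hx
  have hy₀ := hc.trans_le hy
  rw [inv_sub_inv hx₀.ne' hy₀.ne', abs_div, abs_sub_comm, abs_of_pos (mul_pos hx₀ hy₀),
    div_eq_inv_mul]
  gcongr

/-- **Szegő's limit theorem** for log-determinants of Toeplitz matrices. -/
lemma tendsto_log_det_toeplitz_div (hKe : ∀ m, K (-m) = K m) (hK : Summable fun m => |K m|)
    {c : ℝ} (hc₀ : 0 < c) (hc : ∀ θ ∈ Set.Icc (0 : ℝ) 1, c ≤ spectrum' K θ) :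
    Tendsto (fun n : ℕ => Real.log (toeplitz K n).det / n) atTop
      (nhds (∫ θ in (0 : ℝ)..1, Real.log (spectrum' K θ))) := by
  have h := tendsto_sum_eigenvalues_mul_toeplitz hKe hK even_single summable_abs_single hc
    (inv_nonneg.2 hc₀.le) (fun x y => abs_log_sub_log_le hc₀) (isHermitian_toeplitz hKe)
  simp only [toeplitz_single, one_mulVec, eigenvec_dotProduct_self, spectrum'_single, mul_one,
    one_mul] at h
  refine h.congr fun n => ?_
  rw [log_det_eq_sum _ fun i => (hc₀.trans_le (le_eigenvalues _
    (mul_dotProduct_self_le_toeplitz hKe hK hc) i)).ne']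

lemma tendsto_trace_inv_toeplitz_mul_div {L : ℤ → ℝ} (hKe : ∀ m, K (-m) = K m)
    (hK : Summable fun m => |K m|) (hLe : ∀ m, L (-m) = L m) (hL : Summable fun m => |L m|)
    {c : ℝ} (hc₀ : 0 < c) (hc : ∀ θ ∈ Set.Icc (0 : ℝ) 1, c ≤ spectrum' K θ) :
    Tendsto (fun n : ℕ => ((toeplitz K n)⁻¹ * toeplitz L n).trace / n) atTop
      (nhds (∫ θ in (0 : ℝ)..1, spectrum' L θ / spectrum' K θ)) := by
  have h := tendsto_sum_eigenvalues_mul_toeplitz hKe hK hLe hL hc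
    (φ := fun x => x⁻¹) (inv_nonneg.2 (mul_self_nonneg c))
    (fun x y => abs_inv_sub_inv_le hc₀) (isHermitian_toeplitz hKe)
  simp only [← div_eq_mul_inv] at h
  refine h.congr fun n => ?_
  rw [trace_inv_mul_eq_sum _ fun i => (hc₀.trans_le (le_eigenvalues _
    (mul_dotProduct_self_le_toeplitz hKe hK hc) i)).ne']

end SpectralLimit

/-- **Linear growth of the relative entropy between stationary Gaussian laws.** If the spectra
`S_p`, `S_q` of even, absolutely summable auto-covariances `K_p`, `K_q` are bounded between
`0 < c` and `M` on `[0,1]`, then the relative entropy `D_n` (in nats) between the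
`n`-dimensional Gaussians with Toeplitz covariances satisfies `D_n / n → C_s`, where
`C_s = (1/2) ∫₀¹ (S_p/S_q - ln (S_p/S_q) - 1) df`. -/
theorem relEntropy_gaussian_toeplitz_linear_growth
    (Kp Kq : ℤ → ℝ)
    (hKp_even : ∀ m, Kp (-m) = Kp m) (hKq_even : ∀ m, Kq (-m) = Kq m)
    (hKp_sum : Summable fun m : ℤ => |Kp m|) (hKq_sum : Summable fun m : ℤ => |Kq m|)
    (c M : ℝ) (hc : 0 < c) (hcM : c ≤ M)
    (hSp : ∀ f ∈ Set.Icc (0 : ℝ) 1, c ≤ spectrum' Kp f ∧ spectrum' Kp f ≤ M)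
    (hSq : ∀ f ∈ Set.Icc (0 : ℝ) 1, c ≤ spectrum' Kq f ∧ spectrum' Kq f ≤ M) :
    Tendsto (fun n : ℕ =>
        relEntropyNats (gaussianMeasure n (toeplitz Kp n)) (gaussianMeasure n (toeplitz Kq n))
          / (n : ℝ))
      atTop
      (nhds ((1 / 2) * ∫ f in (0 : ℝ)..1,
        (spectrum' Kp f / spectrum' Kq f - Real.log (spectrum' Kp f / spectrum' Kq f) - 1))) := by
  have hSpc := continuous_spectrum' hKp_sum
  have hSqc := continuous_spectrum' hKq_sum
  have hSp₀ : ∀ f ∈ Set.uIcc (0 : ℝ) 1, spectrum' Kp f ≠ 0 := fun f hf =>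
    (hc.trans_le (hSp f (Set.uIcc_of_le (zero_le_one' ℝ) ▸ hf)).1).ne'
  have hSq₀ : ∀ f ∈ Set.uIcc (0 : ℝ) 1, spectrum' Kq f ≠ 0 := fun f hf =>
    (hc.trans_le (hSq f (Set.uIcc_of_le (zero_le_one' ℝ) ▸ hf)).1).ne'
  have hdiv : IntervalIntegrable (fun f => spectrum' Kp f / spectrum' Kq f) volume 0 1 :=
    (hSpc.continuousOn.div hSqc.continuousOn hSq₀).intervalIntegrable
  have hlogp : IntervalIntegrable (fun f => Real.log (spectrum' Kp f)) volume 0 1 :=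
    (hSpc.continuousOn.log hSp₀).intervalIntegrable
  have hlogq : IntervalIntegrable (fun f => Real.log (spectrum' Kq f)) volume 0 1 :=
    (hSqc.continuousOn.log hSq₀).intervalIntegrable
  have hlim : ∫ f in (0 : ℝ)..1,
      (spectrum' Kp f / spectrum' Kq f - Real.log (spectrum' Kp f / spectrum' Kq f) - 1)
      = (∫ f in (0 : ℝ)..1, spectrum' Kp f / spectrum' Kq f) - 1
        - ((∫ f in (0 : ℝ)..1, Real.log (spectrum' Kp f))
          - ∫ f in (0 : ℝ)..1, Real.log (spectrum' Kq f)) := by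
    have hcongr : ∫ f in (0 : ℝ)..1,
        (spectrum' Kp f / spectrum' Kq f - Real.log (spectrum' Kp f / spectrum' Kq f) - 1)
        = ∫ f in (0 : ℝ)..1, (spectrum' Kp f / spectrum' Kq f
          - (Real.log (spectrum' Kp f) - Real.log (spectrum' Kq f)) - 1) :=
      intervalIntegral.integral_congr fun f hf => by
        simp only [Real.log_div (hSp₀ f hf) (hSq₀ f hf)]
    rw [hcongr, intervalIntegral.integral_sub (hdiv.sub (hlogp.sub hlogq)) (by simp),
      intervalIntegral.integral_sub hdiv (hlogp.sub hlogq),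
      intervalIntegral.integral_sub hlogp hlogq, intervalIntegral.integral_const]
    simp only [sub_zero, one_smul]
    ring
  rw [hlim]
  refine Tendsto.congr' ?_ ((((tendsto_trace_inv_toeplitz_mul_div hKq_even hKq_sum hKp_even
    hKp_sum hc fun f hf => (hSq f hf).1).sub_const 1).sub
    ((tendsto_log_det_toeplitz_div hKp_even hKp_sum hc fun f hf => (hSp f hf).1).sub
      (tendsto_log_det_toeplitz_div hKq_even hKq_sum hc fun f hf => (hSq f hf).1))).const_mul
    (1 / 2))
  filter_upwards [eventually_ne_atTop 0] with n hn
  have hn' : (n : ℝ) ≠ 0 := mod_cast hn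
  rw [relEntropyNats_gaussianMeasure
    (posDef_toeplitz hKp_even hKp_sum hc (fun f hf => (hSp f hf).1) n)
    (posDef_toeplitz hKq_even hKq_sum hc (fun f hf => (hSq f hf).1) n)]
  field_simp
end
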